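/- arXiv:2508.13539 — 6 statements merged into one kernel-verified Lean document; each statement's English description precedes it below -/
import Mathlib

section
/- Let N ≥ 2 be an integer, p a real with 1 < p < N and α > 0, and set q := p*_α = p(N+α)/(N−p). Suppose u, v : [0,∞) → ℝ are continuous functions with u(r) > 0 and v(r) > 0 for all r ≥ 0, u(0) = v(0) = 1, both differentiable on (0,∞), and for every r > 0: u'(r) = −( (q−1)/((p−1) r^{N−1}) · ∫₀^r t^{N+α−1} u(t)^{q−1} dt )^{1/(p−1)} and v'(r) = −( (q−1)/((p−1) r^{N−1}) · ∫₀^r t^{N+α−1} v(t)^{q−1} dt )^{1/(p−1)}. Then u(r) = v(r) for all r ≥ 0. (This is the uniqueness of normalized radial solutions of the critical quasi-linear Hénon ODE.) -/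
open MeasureTheory Real intervalIntegral

noncomputable section

/-- The critical Hénon exponent `p*_α = p(N+α)/(N-p)`. -/
def pS (N p α : ℝ) : ℝ := p * (N + α) / (N - p)

/-- Gronwall-type uniqueness: a function vanishing at `0` whose derivative at `r` is controlled by
its supremum on `[0, r]` vanishes identically. -/
lemma eq_zero_of_abs_deriv_le_bound {w w' : ℝ → ℝ} {R M : ℝ} (hM : 0 < M)
    (hw : ContinuousOn w (Set.Icc 0 R)) (hw0 : w 0 = 0)
    (hd : ∀ r ∈ Set.Ioo 0 R, HasDerivAt w (w' r) r)
    (hb : ∀ r ∈ Set.Ioo 0 R, ∀ B, (∀ t ∈ Set.Icc 0 r, |w t| ≤ B) → |w' r| ≤ M * B) :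
    ∀ r ∈ Set.Icc 0 R, w r = 0 := by
  intro r hr
  have hE : ∀ t, HasDerivAt (fun t => exp (M * t)) (exp (M * t) * M) t := fun t => by
    simpa using ((hasDerivAt_id t).const_mul M).exp
  obtain ⟨t₀, ht₀, hmax⟩ := isCompact_Icc.exists_isMaxOn ⟨r, hr⟩
    (f := fun t => |w t| * exp (-(M * t))) (by fun_prop)
  set S := |w t₀| * exp (-(M * t₀)) with hS
  have hS0 : 0 ≤ S := by positivity
  have hle : ∀ t ∈ Set.Icc 0 R, |w t| ≤ S * exp (M * t) := fun t ht => by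
    have h1 : |w t| * exp (-(M * t)) ≤ S := hmax ht
    rwa [exp_neg, ← div_eq_mul_inv, div_le_iff₀ (exp_pos _)] at h1
  have hder : ∀ t ∈ Set.Ioo 0 R, |w' t| ≤ S * (exp (M * t) * M) := fun t ht => by
    have h1 := hb t ht (S * exp (M * t)) fun s hs =>
      (hle s ⟨hs.1, hs.2.trans ht.2.le⟩).trans (by have := hs.2; gcongr)
    linarith
  have hmono : ∀ σ : ℝ, |σ| = 1 →
      MonotoneOn (fun t => S * exp (M * t) + σ * w t) (Set.Icc 0 R) := by
    intro σ hσ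
    have hd' : ∀ t ∈ interior (Set.Icc 0 R), HasDerivAt (fun t => S * exp (M * t) + σ * w t)
        (S * (exp (M * t) * M) + σ * w' t) t := fun t ht => by
      rw [interior_Icc] at ht
      exact ((hE t).const_mul S).add ((hd t ht).const_mul σ)
    refine monotoneOn_of_deriv_nonneg (convex_Icc 0 R) (by fun_prop)
      (fun t ht => (hd' t ht).differentiableAt.differentiableWithinAt) fun t ht => ?_
    rw [(hd' t ht).deriv]
    rw [interior_Icc] at ht
    have h1 := neg_abs_le (σ * w' t)
    rw [abs_mul, hσ, one_mul] at h1
    linarith [hder t ht]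
  have h0 : (0 : ℝ) ∈ Set.Icc 0 R := ⟨le_rfl, hr.1.trans hr.2⟩
  have h1 := hmono 1 (by simp) h0 ht₀ ht₀.1
  have h2 := hmono (-1) (by simp) h0 ht₀ ht₀.1
  simp only [hw0, mul_zero, exp_zero] at h1 h2
  have h3 : |w t₀| ≤ S * exp (M * t₀) - S := abs_le.2 ⟨by linarith, by linarith⟩
  have h4 : S * exp (M * t₀) = |w t₀| := by
    rw [hS, mul_assoc, ← exp_add]; simp
  have hS' : S = 0 := by linarith
  have h5 := hle r hr
  rw [hS', zero_mul] at h5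
  exact abs_nonpos_iff.1 h5

/-- Real powers are Lipschitz on compact intervals of positive numbers. -/
lemma exists_abs_rpow_sub_rpow_le {a : ℝ} (ha : 0 < a) (b s : ℝ) :
    ∃ L, 0 < L ∧ ∀ x ∈ Set.Icc a b, ∀ y ∈ Set.Icc a b, |x ^ s - y ^ s| ≤ L * |x - y| := by
  have hc : ContinuousOn (fun x : ℝ => s * x ^ (s - 1)) (Set.Icc a b) := fun x hx =>
    ((continuousAt_rpow_const x _ (Or.inl (ha.trans_le hx.1).ne')).const_mul s).continuousWithinAt
  obtain ⟨C, hC⟩ := isCompact_Icc.exists_bound_of_continuousOn hc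
  refine ⟨max C 1, by positivity, fun x hx y hy => ?_⟩
  exact (convex_Icc a b).norm_image_sub_le_of_norm_hasDerivWithin_le
    (f := fun x : ℝ => x ^ s) (f' := fun x => s * x ^ (s - 1))
    (fun z hz => (hasDerivAt_rpow_const (Or.inl (ha.trans_le hz.1).ne')).hasDerivWithinAt)
    (fun z hz => (hC z hz).trans (le_max_left _ _)) hy hx

lemma intervalIntegrable_rpow_mul_rpow {u : ℝ → ℝ} {a m r : ℝ} (ha : 0 < a) (hr : 0 ≤ r)
    (hu : ContinuousOn u (Set.Ici 0)) (hpos : ∀ t, 0 ≤ t → 0 < u t) :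
    IntervalIntegrable (fun t => t ^ a * u t ^ m) volume 0 r := by
  apply ContinuousOn.intervalIntegrable
  rw [Set.uIcc_of_le hr]
  exact (continuous_rpow_const ha.le).continuousOn.mul
    ((hu.mono fun t ht => ht.1).rpow_const fun t ht => Or.inl (hpos t ht.1).ne')

lemma integral_rpow_mul_const {a r : ℝ} (ha : 0 < a) (k : ℝ) :
    ∫ t in (0 : ℝ)..r, t ^ a * k = k / (a + 1) * r ^ (a + 1) := by
  rw [intervalIntegral.integral_mul_const, integral_rpow (Or.inl (by linarith)),
    zero_rpow (by linarith)]
  ring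

lemma intervalIntegrable_rpow_mul_const {a r : ℝ} (ha : 0 < a) (k : ℝ) :
    IntervalIntegrable (fun t : ℝ => t ^ a * k) volume 0 r :=
  ((continuous_rpow_const ha.le).mul continuous_const).intervalIntegrable _ _

lemma integral_rpow_mul_rpow_div_mem_Icc {u : ℝ → ℝ} {a m r c C : ℝ} (ha : 0 < a) (hm : 0 ≤ m)
    (hr : 0 < r) (hc : 0 < c) (hu : ContinuousOn u (Set.Ici 0)) (hpos : ∀ t, 0 ≤ t → 0 < u t)
    (hmem : ∀ t ∈ Set.Icc 0 r, u t ∈ Set.Icc c C) :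
    (∫ t in (0 : ℝ)..r, t ^ a * u t ^ m) / r ^ (a + 1) ∈
      Set.Icc (c ^ m / (a + 1)) (C ^ m / (a + 1)) := by
  have hi := intervalIntegrable_rpow_mul_rpow (m := m) ha hr.le hu hpos
  have hr' : 0 < r ^ (a + 1) := rpow_pos_of_pos hr _
  constructor
  · rw [le_div_iff₀ hr', ← integral_rpow_mul_const ha]
    refine integral_mono_on hr.le (intervalIntegrable_rpow_mul_const ha _) hi fun t ht => ?_
    exact mul_le_mul_of_nonneg_left (rpow_le_rpow hc.le (hmem t ht).1 hm) (rpow_nonneg ht.1 _)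
  · rw [div_le_iff₀ hr', ← integral_rpow_mul_const ha]
    refine integral_mono_on hr.le hi (intervalIntegrable_rpow_mul_const ha _) fun t ht => ?_
    exact mul_le_mul_of_nonneg_left (rpow_le_rpow (hpos t ht.1).le (hmem t ht).2 hm)
      (rpow_nonneg ht.1 _)

lemma abs_integral_rpow_mul_rpow_div_sub_le {u v : ℝ → ℝ} {a m r K : ℝ} (ha : 0 < a)
    (hr : 0 < r) (hu : ContinuousOn u (Set.Ici 0)) (hupos : ∀ t, 0 ≤ t → 0 < u t)
    (hv : ContinuousOn v (Set.Ici 0)) (hvpos : ∀ t, 0 ≤ t → 0 < v t)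
    (hK : ∀ t ∈ Set.Icc 0 r, |u t ^ m - v t ^ m| ≤ K) :
    |(∫ t in (0 : ℝ)..r, t ^ a * u t ^ m) / r ^ (a + 1) -
      (∫ t in (0 : ℝ)..r, t ^ a * v t ^ m) / r ^ (a + 1)| ≤ K / (a + 1) := by
  have hr' : 0 < r ^ (a + 1) := rpow_pos_of_pos hr _
  rw [← sub_div, ← integral_sub (intervalIntegrable_rpow_mul_rpow ha hr.le hu hupos)
    (intervalIntegrable_rpow_mul_rpow ha hr.le hv hvpos), abs_div, abs_of_pos hr',
    div_le_iff₀ hr', ← integral_rpow_mul_const ha, ← norm_eq_abs]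
  refine norm_integral_le_of_norm_le hr.le (ae_of_all _ fun t ht => ?_)
    (intervalIntegrable_rpow_mul_const ha _)
  rw [← mul_sub, norm_mul, norm_eq_abs, norm_eq_abs, abs_of_nonneg (rpow_nonneg ht.1.le _)]
  exact mul_le_mul_of_nonneg_left (hK t ⟨ht.1.le, ht.2⟩) (rpow_nonneg ht.1.le _)

lemma one_lt_pS {N p α : ℝ} (hp : 1 < p) (hpN : p < N) (hα : 0 < α) : 1 < pS N p α := by
  rw [pS, one_lt_div (by linarith)]
  nlinarith

/-- Uniqueness of normalized radial solutions of the critical quasi-linear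
Hénon ODE: if `u, v` are positive continuous functions on `[0,∞)` with `u(0) = v(0) = 1`,
both differentiable on `(0,∞)` and satisfying
`u'(r) = -((q-1)/((p-1) r^{N-1}) ∫₀^r t^{N+α-1} u(t)^{q-1} dt)^{1/(p-1)}` (and the same
equation for `v`), where `q = p*_α`, then `u ≡ v` on `[0,∞)`. -/
theorem stmt_1 (N : ℕ) (hN : 2 ≤ N) (p α : ℝ) (hp1 : 1 < p) (hpN : p < N) (hα : 0 < α)
    (u v : ℝ → ℝ)
    (hu_cont : ContinuousOn u (Set.Ici 0)) (hv_cont : ContinuousOn v (Set.Ici 0))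
    (hu_pos : ∀ r : ℝ, 0 ≤ r → 0 < u r) (hv_pos : ∀ r : ℝ, 0 ≤ r → 0 < v r)
    (hu0 : u 0 = 1) (hv0 : v 0 = 1)
    (hu : ∀ r : ℝ, 0 < r → HasDerivAt u
      (-((((pS N p α - 1) / ((p - 1) * r ^ ((N : ℝ) - 1))) *
          ∫ t in (0 : ℝ)..r, t ^ ((N : ℝ) + α - 1) * u t ^ (pS N p α - 1)) ^
        (1 / (p - 1)))) r)
    (hv : ∀ r : ℝ, 0 < r → HasDerivAt v
      (-((((pS N p α - 1) / ((p - 1) * r ^ ((N : ℝ) - 1))) *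
          ∫ t in (0 : ℝ)..r, t ^ ((N : ℝ) + α - 1) * v t ^ (pS N p α - 1)) ^
        (1 / (p - 1)))) r) :
    ∀ r : ℝ, 0 ≤ r → u r = v r := by
  have hN' : (2 : ℝ) ≤ N := by exact_mod_cast hN
  have hm : 0 < pS N p α - 1 := sub_pos.2 (one_lt_pS hp1 hpN hα)
  generalize pS N p α - 1 = m at *
  have hβ : 0 < 1 / (p - 1) := one_div_pos.2 (by linarith)
  have ha : 0 < (N : ℝ) + α - 1 := by linarith
  have hk : 0 < m / (p - 1) := div_pos hm (by linarith)
  generalize hadef : (N : ℝ) + α - 1 = a at *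
  generalize 1 / (p - 1) = β at *
  intro R hR
  rcases hR.eq_or_lt with rfl | hR
  · rw [hu0, hv0]
  have hne : (Set.Icc 0 R).Nonempty := ⟨0, le_rfl, hR.le⟩
  have hucR : ContinuousOn u (Set.Icc 0 R) := hu_cont.mono fun t ht => ht.1
  have hvcR : ContinuousOn v (Set.Icc 0 R) := hv_cont.mono fun t ht => ht.1
  obtain ⟨t₁, ht₁, hmin⟩ := isCompact_Icc.exists_isMinOn hne
    (f := fun t => min (u t) (v t)) (by fun_prop)
  obtain ⟨t₂, ht₂, hmax⟩ := isCompact_Icc.exists_isMaxOn hne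
    (f := fun t => max (u t) (v t)) (by fun_prop)
  set c := min (u t₁) (v t₁)
  set C := max (u t₂) (v t₂)
  have hc : 0 < c := lt_min (hu_pos _ ht₁.1) (hv_pos _ ht₁.1)
  have hum : ∀ t ∈ Set.Icc 0 R, u t ∈ Set.Icc c C := fun t ht =>
    ⟨(show c ≤ min (u t) (v t) from hmin ht).trans (min_le_left _ _), (le_max_left _ _).trans (show max (u t) (v t) ≤ C from hmax ht)⟩
  have hvm : ∀ t ∈ Set.Icc 0 R, v t ∈ Set.Icc c C := fun t ht =>
    ⟨(show c ≤ min (u t) (v t) from hmin ht).trans (min_le_right _ _), (le_max_right _ _).trans (show max (u t) (v t) ≤ C from hmax ht)⟩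
  obtain ⟨L₁, hL₁, hLip₁⟩ := exists_abs_rpow_sub_rpow_le hc C m
  obtain ⟨L₂, hL₂, hLip₂⟩ := exists_abs_rpow_sub_rpow_le
    (a := c ^ m / (a + 1)) (by positivity) (C ^ m / (a + 1)) β
  have hfactor : ∀ r I : ℝ, 0 < r → 0 ≤ I / r ^ (a + 1) →
      (m / ((p - 1) * r ^ ((N : ℝ) - 1)) * I) ^ β =
        (m / (p - 1) * r ^ (α + 1)) ^ β * (I / r ^ (a + 1)) ^ β := by
    intro r I hr hI
    rw [← mul_rpow (by positivity) hI, show a + 1 = (α + 1) + ((N : ℝ) - 1) by linarith,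
      rpow_add hr (α + 1)]
    congr 1
    have h1 := (rpow_pos_of_pos hr (α + 1)).ne'
    have h2 := (rpow_pos_of_pos hr ((N : ℝ) - 1)).ne'
    have h3 : p - 1 ≠ 0 := by linarith
    field_simp
  refine sub_eq_zero.1 (eq_zero_of_abs_deriv_le_bound (w := fun t => u t - v t)
    (M := (m / (p - 1) * R ^ (α + 1)) ^ β * (L₂ * (L₁ / (a + 1)))) (R := R) (by positivity)
    (hucR.sub hvcR) (by simp [hu0, hv0]) (fun r hr => (hu r hr.1).sub (hv r hr.1)) ?_ R
    ⟨hR.le, le_rfl⟩)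
  intro r hr B hB
  have hsub : ∀ t ∈ Set.Icc 0 r, t ∈ Set.Icc 0 R := fun t ht => ⟨ht.1, ht.2.trans hr.2.le⟩
  have hr0 : 0 < r := hr.1
  have hIu := integral_rpow_mul_rpow_div_mem_Icc ha hm.le hr0 hc hu_cont hu_pos
    fun t ht => hum t (hsub t ht)
  have hIv := integral_rpow_mul_rpow_div_mem_Icc ha hm.le hr0 hc hv_cont hv_pos
    fun t ht => hvm t (hsub t ht)
  have hdiff := abs_integral_rpow_mul_rpow_div_sub_le (m := m) (K := L₁ * B) ha hr0
    hu_cont hu_pos hv_cont hv_pos fun t ht =>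
      (hLip₁ _ (hum t (hsub t ht)) _ (hvm t (hsub t ht))).trans
        (mul_le_mul_of_nonneg_left (hB t ht) hL₁.le)
  have hB0 : 0 ≤ B := (abs_nonneg _).trans (hB 0 ⟨le_rfl, hr0.le⟩)
  have hlow : 0 ≤ c ^ m / (a + 1) := by positivity
  rw [hfactor r _ hr0 (hlow.trans hIu.1), hfactor r _ hr0 (hlow.trans hIv.1), neg_sub_neg,
    ← mul_sub, abs_mul, abs_sub_comm, abs_of_nonneg (by positivity), mul_assoc]
  have hrR : r ≤ R := hr.2.le
  refine mul_le_mul (by gcongr) ?_ (abs_nonneg _) (by positivity)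
  calc _ ≤ L₂ * _ := hLip₂ _ hIu _ hIv
    _ ≤ L₂ * (L₁ * B / (a + 1)) := by gcongr
    _ = L₂ * (L₁ / (a + 1)) * B := by ring
end
end

section
/- Let N ≥ 2 be an integer, p a real with 1 < p < N and α ≥ 0. Define Z(r) := ((p−1) − r^{(p+α)/(p−1)}) · (1 + r^{(p+α)/(p−1)})^{−(N+α)/(p+α)} for r > 0. Then the function r ↦ r^{N−1} (−U_α'(r))^{p−2} Z'(r) is differentiable on (0,∞) and for every r > 0: −(p−1) · d/dr [ r^{N−1} (−U_α'(r))^{p−2} Z'(r) ] = (p*_α − 1) r^{N+α−1} U_α(r)^{p*_α−2} Z(r). (That is, Z is a classical radial solution of the equation obtained by linearizing −Δ_p u = |x|^α u^{p*_α−1} at U_α.) -/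
open MeasureTheory Real

noncomputable section

/-- The normalizing constant `C_{N,p,α}`. -/
def Cnpa (N p α : ℝ) : ℝ :=
  ((N + α) * ((N - p) / (p - 1)) ^ (p - 1)) ^ ((N - p) / (p * (p + α)))

/-- The radial profile `U_α(r)` of the standard solution. -/
def Urad (N p α r : ℝ) : ℝ :=
  Cnpa N p α * (1 + r ^ ((p + α) / (p - 1))) ^ (-((N - p) / (p + α)))

/-- The derivative of `x ↦ (1 + x ^ a) ^ e` on the positive half-line. -/
theorem hasDerivAt_one_add_rpow_rpow (a e : ℝ) {r : ℝ} (hr : 0 < r) :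
    HasDerivAt (fun x : ℝ => (1 + x ^ a) ^ e)
      (a * r ^ (a - 1) * e * (1 + r ^ a) ^ (e - 1)) r := by
  have h1 : HasDerivAt (fun x : ℝ => 1 + x ^ a) (a * r ^ (a - 1)) r :=
    (Real.hasDerivAt_rpow_const (Or.inl hr.ne')).const_add 1
  exact h1.rpow_const (Or.inl (by positivity))

theorem Cnpa_pos {N p α : ℝ} (hp1 : 1 < p) (hpN : p < N) (hα : 0 ≤ α) : 0 < Cnpa N p α := by
  have h1 : 0 < p - 1 := by linarith
  have h2 : 0 < N - p := by linarith
  have h3 : 0 < N + α := by linarith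
  unfold Cnpa
  positivity

/-- The normalization of `Cnpa`: it turns the `p`-homogeneity defect into the factor
`(N + α) ((N - p) / (p - 1)) ^ (p - 1)`. -/
theorem Cnpa_rpow_pS_sub {N p α : ℝ} (hp1 : 1 < p) (hpN : p < N) (hα : 0 ≤ α) :
    Cnpa N p α ^ (pS N p α - p) = (N + α) * ((N - p) / (p - 1)) ^ (p - 1) := by
  have h1 : 0 < p - 1 := by linarith
  have h2 : 0 < N - p := by linarith
  have h3 : 0 < N + α := by linarith
  have h4 : 0 < p + α := by linarith
  have hp : 0 < p := by linarith
  unfold Cnpa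
  rw [← Real.rpow_mul (by positivity)]
  have he : (N - p) / (p * (p + α)) * (pS N p α - p) = 1 := by
    unfold pS
    field_simp
    ring
  rw [he, Real.rpow_one]

theorem neg_deriv_Urad {N p α r : ℝ} (hp1 : 1 < p) (hα : 0 ≤ α) (hr : 0 < r) :
    -(deriv (Urad N p α) r) = Cnpa N p α * ((N - p) / (p - 1)) *
      (r ^ ((p + α) / (p - 1) - 1) * (1 + r ^ ((p + α) / (p - 1))) ^ (-((N + α) / (p + α)))) := by
  have h1 : 0 < p - 1 := by linarith
  have h4 : 0 < p + α := by linarith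
  have hd : deriv (Urad N p α) r = _ :=
    ((hasDerivAt_one_add_rpow_rpow ((p + α) / (p - 1)) (-((N - p) / (p + α))) hr).const_mul
      (Cnpa N p α)).deriv
  have he : -((N - p) / (p + α)) - 1 = -((N + α) / (p + α)) := by
    field_simp
    ring
  rw [hd, he]
  field_simp

/-- The derivative of `x ↦ (c - x ^ a) (1 + x ^ a) ^ (-m)` on the positive half-line. -/
theorem deriv_sub_rpow_mul_one_add_rpow (a c m : ℝ) {r : ℝ} (hr : 0 < r) :
    deriv (fun x : ℝ => (c - x ^ a) * (1 + x ^ a) ^ (-m)) r =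
      -(a * r ^ (a - 1) * (1 + r ^ a) ^ (-m - 1) * (1 + m * c - (m - 1) * r ^ a)) := by
  have hd := (((Real.hasDerivAt_rpow_const (p := a) (Or.inl hr.ne')).const_sub c).mul
    (hasDerivAt_one_add_rpow_rpow a (-m) hr)).deriv
  have hw : 0 < 1 + r ^ a := by positivity
  refine hd.trans ?_
  rw [Real.rpow_sub_one hw.ne']
  field_simp
  ring

/-- The derivative of `x ↦ x ^ (s a) (1 + x ^ a) ^ (-s - 1) (1 + s - (m - 1) x ^ a)` on the
positive half-line factors. -/
theorem hasDerivAt_rpow_mul_one_add_rpow (a s m : ℝ) {r : ℝ} (hr : 0 < r) :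
    HasDerivAt (fun x : ℝ => x ^ (s * a) * (1 + x ^ a) ^ (-s - 1) * (1 + s - (m - 1) * x ^ a))
      (a * (1 + s) * r ^ (s * a - 1) * (1 + r ^ a) ^ (-s - 2) * (s - m * r ^ a)) r := by
  have hd := ((Real.hasDerivAt_rpow_const (p := s * a) (Or.inl hr.ne')).mul
    (hasDerivAt_one_add_rpow_rpow a (-s - 1) hr)).mul
    (((Real.hasDerivAt_rpow_const (p := a) (Or.inl hr.ne')).const_mul (m - 1)).const_sub (1 + s))
  have hw : 0 < 1 + r ^ a := by positivity
  refine hd.congr_deriv ?_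
  simp only [Pi.mul_apply]
  have e2 : (1 + r ^ a) ^ (-s - 1) = (1 + r ^ a) ^ (-s - 2) * (1 + r ^ a) := by
    rw [← Real.rpow_add_one hw.ne']
    congr 1
    ring
  have e1 : (-s - 1 - 1 : ℝ) = -s - 2 := by ring
  rw [e1, e2, Real.rpow_sub_one hr.ne', Real.rpow_sub_one hr.ne']
  field_simp
  ring

/-- The function
`Z(r) = ((p-1) - r^{(p+α)/(p-1)}) (1 + r^{(p+α)/(p-1)})^{-(N+α)/(p+α)}` is a classical
radial solution of the linearization of `-Δ_p u = |x|^α u^{p*_α-1}` at `U_α`: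
`r ↦ r^{N-1}(-U_α'(r))^{p-2} Z'(r)` is differentiable on `(0,∞)` and
`-(p-1) d/dr [r^{N-1}(-U_α'(r))^{p-2} Z'(r)] = (p*_α-1) r^{N+α-1} U_α(r)^{p*_α-2} Z(r)`. -/
theorem stmt_2 (N : ℕ) (hN : 2 ≤ N) (p α : ℝ) (hp1 : 1 < p) (hpN : p < N) (hα : 0 ≤ α) :
    ∀ Z F : ℝ → ℝ,
      (Z = fun r => ((p - 1) - r ^ ((p + α) / (p - 1))) *
        (1 + r ^ ((p + α) / (p - 1))) ^ (-(((N : ℝ) + α) / (p + α)))) →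
      (F = fun r => r ^ ((N : ℝ) - 1) * (-(deriv (Urad N p α) r)) ^ (p - 2) * deriv Z r) →
      ∀ r : ℝ, 0 < r →
        DifferentiableAt ℝ F r ∧
        -(p - 1) * deriv F r =
          (pS N p α - 1) * r ^ ((N : ℝ) + α - 1) * (Urad N p α r) ^ (pS N p α - 2) * Z r := by
  rintro Z F rfl rfl r hr
  have h1 : 0 < p - 1 := by linarith
  have h2 : 0 < (N : ℝ) - p := by linarith
  have h3 : 0 < (N : ℝ) + α := by linarith
  have h4 : 0 < p + α := by linarith
  have hC := Cnpa_pos hp1 hpN hα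
  have hCp := Cnpa_rpow_pS_sub hp1 hpN hα
  set C := Cnpa N p α with hCdef
  set q := ((N : ℝ) - p) / (p - 1) with hq
  set a := (p + α) / (p - 1) with ha
  set m := ((N : ℝ) + α) / (p + α) with hm
  have hq0 : 0 < q := by positivity
  have hsa : m * (p - 1) * a = N + α := by
    rw [hm, ha]
    field_simp
  have hFG : ∀ x : ℝ, 0 < x →
      x ^ ((N : ℝ) - 1) * (-(deriv (Urad N p α) x)) ^ (p - 2) *
        deriv (fun r => ((p - 1) - r ^ a) * (1 + r ^ a) ^ (-m)) x =
      -(a * (C * q) ^ (p - 2)) * (x ^ (m * (p - 1) * a) * (1 + x ^ a) ^ (-(m * (p - 1)) - 1) *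
        (1 + m * (p - 1) - (m - 1) * x ^ a)) := by
    intro x hx
    have hw : 0 < 1 + x ^ a := by positivity
    rw [neg_deriv_Urad hp1 hα hx, deriv_sub_rpow_mul_one_add_rpow a (p - 1) m hx,
      ← hCdef, ← hq, ← ha, ← hm, Real.mul_rpow (x := C * q) (by positivity) (by positivity),
      Real.mul_rpow (x := x ^ (a - 1)) (by positivity) (by positivity),
      ← Real.rpow_mul hx.le, ← Real.rpow_mul hw.le]
    have ex : x ^ (m * (p - 1) * a) =
        x ^ ((N : ℝ) - 1) * x ^ ((a - 1) * (p - 2)) * x ^ (a - 1) := by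
      rw [← Real.rpow_add hx, ← Real.rpow_add hx, hsa, ha]
      congr 1
      field_simp
      ring
    have ew : (1 + x ^ a) ^ (-(m * (p - 1)) - 1) =
        (1 + x ^ a) ^ (-m * (p - 2)) * (1 + x ^ a) ^ (-m - 1) := by
      rw [← Real.rpow_add hw]
      congr 1
      ring
    rw [ex, ew]
    ring
  have hG := ((hasDerivAt_rpow_mul_one_add_rpow a (m * (p - 1)) m hr).const_mul
    (-(a * (C * q) ^ (p - 2)))).congr_of_eventuallyEq
    ((eventually_gt_nhds hr).mono hFG)
  refine ⟨hG.differentiableAt, ?_⟩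
  rw [hG.deriv, hsa]
  have hw : 0 < 1 + r ^ a := by positivity
  have eU : Urad N p α r ^ (pS N p α - 2) = C ^ (pS N p α - 2) *
      (1 + r ^ a) ^ (-(((N : ℝ) - p) / (p + α)) * (pS N p α - 2)) := by
    unfold Urad
    rw [Real.mul_rpow hC.le (by positivity), ← Real.rpow_mul hw.le]
  have ew : (1 + r ^ a) ^ (-(m * (p - 1)) - 2) =
      (1 + r ^ a) ^ (-(((N : ℝ) - p) / (p + α)) * (pS N p α - 2)) * (1 + r ^ a) ^ (-m) := by
    rw [← Real.rpow_add hw, hm, pS]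
    congr 1
    field_simp
    ring
  have eC : C ^ (pS N p α - 2) = (N + α) * q * (C * q) ^ (p - 2) := by
    have e1 : pS N p α - 2 = (pS N p α - p) + (p - 2) := by ring
    have e2 : p - 1 = (p - 2) + 1 := by ring
    rw [e1, Real.rpow_add hC, hCp, e2, Real.rpow_add_one hq0.ne', Real.mul_rpow hC.le hq0.le]
    ring
  have ec : (p - 1) * a * a * (1 + m * (p - 1)) * m = (pS N p α - 1) * (N + α) * q := by
    rw [ha, hm, hq, pS]
    field_simp
    ring
  rw [eU, ew, eC]
  linear_combination (C * q) ^ (p - 2) * r ^ ((N : ℝ) + α - 1) *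
    (1 + r ^ a) ^ (-(((N : ℝ) - p) / (p + α)) * (pS N p α - 2)) * (1 + r ^ a) ^ (-m) *
    (p - 1 - r ^ a) * ec
end
end

section
/- Let N ≥ 2 be an integer, p a real with 1 < p < N and α > 0. For a real k ≥ 0 set λ_k := k(N+k−2), ρ_k := ( √( ((p−2)(N+α)+N−p)² + 4(p−1)λ_k ) − ((p−2)(N+α)+N−p) ) / (2(p−1)), ν_k := ( √( (N−p)² + 4(p−1)λ_k ) + 2ρ_k(p−1) + N−p ) / (2(p+α)), and μ_{1,k} := ( (p+α)² ν_k(ν_k+1) + ν_k (p+α)(p−2)(N+α) ) / ( (N+α)(Np+pα−N+p) ). Let ζ := ( (2p−Np) + √( 4(p−1)α² + 4p(N+p−2)α + N²p² ) ) / (2p). Then the map k ↦ μ_{1,k} is strictly increasing on [0,∞); moreover μ_{1,k} = 1 if and only if k = ζ, and μ_{1,k} < 1 if and only if 0 ≤ k < ζ. -/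
open MeasureTheory Real

noncomputable section

/-- The common form of the two square roots entering `ρ_k` and `ν_k`. -/
theorem strictMonoOn_sqrt_sq_add_mul {n : ℝ} (hn : 2 ≤ n) (a : ℝ) {c : ℝ} (hc : 0 < c) :
    StrictMonoOn (fun k : ℝ => √(a ^ 2 + c * (k * (n + k - 2)))) (Set.Ici 0) := by
  intro x hx y hy hxy
  simp only [Set.mem_Ici] at hx hy
  have h : x * (n + x - 2) < y * (n + y - 2) := by nlinarith
  have h0 : 0 ≤ x * (n + x - 2) := mul_nonneg hx (by linarith)
  exact Real.sqrt_lt_sqrt (by positivity) (by gcongr)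

/-- The eigenvalue `μ_{1,k}` as a quadratic expression in the two square roots `s`, `t`. -/
theorem mu_numerator_eq {n p α s t : ℝ} (hp : 1 < p) (hα : 0 < α) :
    let nu := (s + 2 * ((t - ((p - 2) * (n + α) + n - p)) / (2 * (p - 1))) * (p - 1) + n - p) /
      (2 * (p + α))
    (p + α) ^ 2 * nu * (nu + 1) + nu * (p + α) * (p - 2) * (n + α) =
      ((s + t) ^ 2 - ((p - 2) * (n + α)) ^ 2) / 4
        + (p + α) * (s + t - (p - 2) * (n + α)) / 2 := by
  intro nu
  have hp1 : p - 1 ≠ 0 := by linarith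
  have hpα : p + α ≠ 0 := by linarith
  have hnu : (p + α) * nu = (s + t - (p - 2) * (n + α)) / 2 := by
    simp only [nu]
    field_simp
    ring
  calc _ = ((p + α) * nu) * ((p + α) * nu + (p + α) + (p - 2) * (n + α)) := by ring
    _ = _ := by rw [hnu]; ring

/-- `λ_k` at the critical value `k = ζ`. -/
theorem lam_zeta_eq {n p r : ℝ} (hp : 1 < p) (hr : 0 ≤ r) :
    ((2 * p - n * p) + √r) / (2 * p) * (n + ((2 * p - n * p) + √r) / (2 * p) - 2) =
      (r - p ^ 2 * (n - 2) ^ 2) / (4 * p ^ 2) := by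
  have hp0 : p ≠ 0 := by linarith
  have hs := Real.sq_sqrt hr
  field_simp
  linear_combination 4 * hs

theorem zeta_nonneg {n p α : ℝ} (hn : 2 ≤ n) (hp : 1 < p) (hα : 0 < α) :
    0 ≤ ((2 * p - n * p) +
      √(4 * (p - 1) * α ^ 2 + 4 * p * (n + p - 2) * α + n ^ 2 * p ^ 2)) / (2 * p) := by
  have h1 : 0 ≤ 4 * (p - 1) * α ^ 2 := mul_nonneg (by linarith) (sq_nonneg α)
  have h2 : 0 ≤ 4 * p * (n + p - 2) * α :=
    mul_nonneg (mul_nonneg (by linarith) (by linarith)) hα.le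
  have h : n * p ≤ √(4 * (p - 1) * α ^ 2 + 4 * p * (n + p - 2) * α + n ^ 2 * p ^ 2) :=
    Real.le_sqrt_of_sq_le (by nlinarith)
  exact div_nonneg (by linarith) (by linarith)

/-- At `k = ζ` the two square roots add up to `p (n + α)`. -/
theorem sqrt_add_sqrt_zeta {n p α : ℝ} (hp : 1 < p) (hpn : p < n) (hα : 0 < α) {l : ℝ}
    (hl : l = (4 * (p - 1) * α ^ 2 + 4 * p * (n + p - 2) * α + n ^ 2 * p ^ 2
      - p ^ 2 * (n - 2) ^ 2) / (4 * p ^ 2)) :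
    √((n - p) ^ 2 + 4 * (p - 1) * l) +
      √(((p - 2) * (n + α) + n - p) ^ 2 + 4 * (p - 1) * l) = p * (n + α) := by
  have hp0 : p ≠ 0 := by linarith
  have hs : √((n - p) ^ 2 + 4 * (p - 1) * l) =
      (2 * (p - 1) * (n + α) - (p - 2) * (n - p)) / p := by
    rw [show (n - p) ^ 2 + 4 * (p - 1) * l =
      ((2 * (p - 1) * (n + α) - (p - 2) * (n - p)) / p) ^ 2 by
        rw [hl]; field_simp; ring]
    exact Real.sqrt_sq (div_nonneg (by nlinarith) (by linarith))
  have ht : √(((p - 2) * (n + α) + n - p) ^ 2 + 4 * (p - 1) * l) =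
      ((p ^ 2 - 2 * p + 2) * (n + α) + (p - 2) * (n - p)) / p := by
    rw [show ((p - 2) * (n + α) + n - p) ^ 2 + 4 * (p - 1) * l =
      (((p ^ 2 - 2 * p + 2) * (n + α) + (p - 2) * (n - p)) / p) ^ 2 by
        rw [hl]; field_simp; ring]
    refine Real.sqrt_sq (div_nonneg ?_ (by linarith))
    have h1 : 0 ≤ (p ^ 2 - 2 * p + 2) * (p + α) :=
      mul_nonneg (by nlinarith [sq_nonneg (p - 1)]) (by linarith)
    have h2 : 0 ≤ p * (p - 1) * (n - p) :=
      mul_nonneg (mul_nonneg (by linarith) (by linarith)) (by linarith)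
    linarith
  rw [hs, ht]
  field_simp
  ring

/-- With `λ_k = k(N+k-2)`, `ρ_k`, `ν_k`, `μ_{1,k}` defined for real
`k ≥ 0` as in the paper, and `ζ = ((2p-Np) + √(4(p-1)α² + 4p(N+p-2)α + N²p²))/(2p)`,
the map `k ↦ μ_{1,k}` is strictly increasing on `[0,∞)`; moreover `μ_{1,k} = 1` iff
`k = ζ`, and `μ_{1,k} < 1` iff `0 ≤ k < ζ`. -/
theorem stmt_5 (N : ℕ) (hN : 2 ≤ N) (p α : ℝ) (hp1 : 1 < p) (hpN : p < N) (hα : 0 < α) :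
    ∀ (lam rho nu mu : ℝ → ℝ) (zeta : ℝ),
      (lam = fun k => k * ((N : ℝ) + k - 2)) →
      (rho = fun k => (Real.sqrt (((p - 2) * ((N : ℝ) + α) + N - p) ^ 2 + 4 * (p - 1) * lam k)
          - ((p - 2) * ((N : ℝ) + α) + N - p)) / (2 * (p - 1))) →
      (nu = fun k => (Real.sqrt (((N : ℝ) - p) ^ 2 + 4 * (p - 1) * lam k)
          + 2 * rho k * (p - 1) + N - p) / (2 * (p + α))) →
      (mu = fun k => ((p + α) ^ 2 * nu k * (nu k + 1) + nu k * (p + α) * (p - 2) * ((N : ℝ) + α)) /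
          (((N : ℝ) + α) * ((N : ℝ) * p + p * α - N + p))) →
      zeta = ((2 * p - (N : ℝ) * p) +
          Real.sqrt (4 * (p - 1) * α ^ 2 + 4 * p * ((N : ℝ) + p - 2) * α + (N : ℝ) ^ 2 * p ^ 2)) /
          (2 * p) →
      StrictMonoOn mu (Set.Ici 0) ∧
      (∀ k : ℝ, 0 ≤ k → (mu k = 1 ↔ k = zeta)) ∧
      (∀ k : ℝ, 0 ≤ k → (mu k < 1 ↔ k < zeta)) := by
  intro lam rho nu mu zeta hlam hrho hnu hmu hzeta
  have hn : (2 : ℝ) ≤ N := by exact_mod_cast hN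
  have hc : 0 < 4 * (p - 1) := by linarith
  have hD : 0 < ((N : ℝ) + α) * ((N : ℝ) * p + p * α - N + p) :=
    mul_pos (by linarith) (by nlinarith)
  set w : ℝ → ℝ := fun k => √(((N : ℝ) - p) ^ 2 + 4 * (p - 1) * (k * ((N : ℝ) + k - 2))) +
    √(((p - 2) * ((N : ℝ) + α) + N - p) ^ 2 + 4 * (p - 1) * (k * ((N : ℝ) + k - 2))) with hw
  have hmuw (k : ℝ) : mu k = ((w k ^ 2 - ((p - 2) * ((N : ℝ) + α)) ^ 2) / 4
      + (p + α) * (w k - (p - 2) * ((N : ℝ) + α)) / 2) /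
      (((N : ℝ) + α) * ((N : ℝ) * p + p * α - N + p)) := by
    subst hmu hnu hrho hlam
    exact congrArg (· / _) (mu_numerator_eq hp1 hα)
  have hwmono : StrictMonoOn w (Set.Ici 0) :=
    (strictMonoOn_sqrt_sq_add_mul hn _ hc).add (strictMonoOn_sqrt_sq_add_mul hn _ hc)
  have hmono : StrictMonoOn mu (Set.Ici 0) := by
    intro x hx y hy hxy
    have hxy' := hwmono hx hy hxy
    have hx0 : 0 ≤ w x := by positivity
    rw [hmuw, hmuw]
    gcongr
  have hz0 : zeta ∈ Set.Ici (0 : ℝ) := by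
    rw [hzeta]
    exact zeta_nonneg hn hp1 hα
  have hwz : w zeta = p * ((N : ℝ) + α) := by
    refine sqrt_add_sqrt_zeta hp1 hpN hα ?_
    rw [hzeta]
    refine lam_zeta_eq hp1 ?_
    have h1 : 0 ≤ 4 * (p - 1) * α ^ 2 := mul_nonneg hc.le (sq_nonneg α)
    have h2 : 0 ≤ 4 * p * ((N : ℝ) + p - 2) * α :=
      mul_nonneg (mul_nonneg (by linarith) (by linarith)) hα.le
    positivity
  have hmuz : mu zeta = 1 := by
    rw [hmuw, hwz, div_eq_one_iff_eq hD.ne']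
    ring
  refine ⟨hmono, fun k hk => ?_, fun k hk => ?_⟩
  · rw [← hmuz]
    exact hmono.injOn.eq_iff hk hz0
  · rw [← hmuz]
    exact hmono.lt_iff_lt hk hz0
end
end

section
/- Let N ≥ 2 be an integer, p a real with 1 < p < N, and let γ be a fixed real with N(N−p)/(Np−(N−p)) < γ < (N−p)/(p−1). Let α_n → α > 0 and ε_n → 0 (ε_n > 0) be sequences, and for each n let v_n be a weak solution of the approximate problem in B_{1/ε_n} with exponent α_n. Suppose there is A > 0 such that for all n: (∫_{ℝ^N}|∇v_n|^p dx)^{1/p} ≤ A and sup_{x∈ℝ^N}(1+|x|)^γ v_n(x) ≤ A. Then there exists C > 0, independent of n, such that v_n(x) ≤ C (1+|x|)^{−(N−p)/(p−1)} for every x ∈ ℝ^N and every n. -/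
open MeasureTheory Real
open scoped RealInnerProductSpace

noncomputable section

/-- `v` is a weak solution of the approximate problem
`-Δ_p v = |x|^α (v + U_α(1/ε))^{p*_α-1}` in `B_{1/ε}`, `v ≥ 0`, `v = 0` outside `B_{1/ε}`. -/
def IsWeakApproxSol (N : ℕ) (p α ε : ℝ) (v : EuclideanSpace ℝ (Fin N) → ℝ) : Prop :=
  Continuous v ∧ ContDiffOn ℝ 1 v (Metric.ball 0 (1 / ε)) ∧ (∀ x, 0 ≤ v x) ∧
  (∀ x : EuclideanSpace ℝ (Fin N), 1 / ε ≤ ‖x‖ → v x = 0) ∧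
  ∀ φ : EuclideanSpace ℝ (Fin N) → ℝ, ContDiff ℝ (⊤ : ℕ∞) φ → HasCompactSupport φ →
    tsupport φ ⊆ Metric.ball 0 (1 / ε) →
    (∫ x, ‖gradient v x‖ ^ (p - 2) * ⟪gradient v x, gradient φ x⟫) =
      ∫ x, ‖x‖ ^ α * (v x + Urad N p α (1 / ε)) ^ (pS N p α - 1) * φ x


section SmoothApproximation

variable {E : Type*} [NormedAddCommGroup E] [NormedSpace ℝ E]

theorem tsupport_fderiv_apply_field_subset (φ : E → ℝ) (X : E → E) :
    tsupport (fun x => fderiv ℝ φ x (X x)) ⊆ tsupport φ := by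
  refine closure_minimal (fun x hx => ?_) (isClosed_tsupport φ)
  refine support_fderiv_subset ℝ (fun h0 => hx ?_)
  simp [h0]

theorem continuous_fderiv_apply_of_tsupport_subset {U : Set E} (hU : IsOpen U) {X : E → E}
    (hX : ContinuousOn X U) {φ : E → ℝ} (hφ : ContDiff ℝ 1 φ) (hφU : tsupport φ ⊆ U) :
    Continuous fun x => fderiv ℝ φ x (X x) := by
  refine continuous_of_tsupport fun x hx => ?_
  have hxU : x ∈ U := hφU (tsupport_fderiv_apply_field_subset φ X hx)
  exact (hφ.continuous_fderiv one_ne_zero).continuousAt.clm_apply (hX.continuousAt (hU.mem_nhds hxU))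

theorem hasCompactSupport_fderiv_apply {φ : E → ℝ} (hφ : HasCompactSupport φ) (X : E → E) :
    HasCompactSupport fun x => fderiv ℝ φ x (X x) :=
  hφ.of_isClosed_subset (isClosed_tsupport _) (tsupport_fderiv_apply_field_subset φ X)

variable [FiniteDimensional ℝ E] [MeasurableSpace E] [BorelSpace E]
  {μ : Measure E} [μ.IsAddHaarMeasure]

open scoped ContDiff Convolution in
/-- The mollification of a compactly supported `C¹` function: it is smooth, nonnegative and
supported near the original support, and its derivative is controlled and averaged. -/
theorem ContDiffBump.normed_convolution_properties (b : ContDiffBump (0 : E)) {φ : E → ℝ}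
    (hφ : ContDiff ℝ 1 φ) (hφc : HasCompactSupport φ) (hφ0 : ∀ x, 0 ≤ φ x) {M : ℝ} (hM0 : 0 ≤ M)
    (hM : ∀ x, ‖fderiv ℝ φ x‖ ≤ M) :
    let ψ := (b.normed μ ⋆[ContinuousLinearMap.lsmul ℝ ℝ, μ] φ)
    ContDiff ℝ ∞ ψ ∧ tsupport ψ ⊆ Metric.cthickening b.rOut (tsupport φ) ∧ (∀ x, 0 ≤ ψ x) ∧
    (∀ x, ‖fderiv ℝ ψ x‖ ≤ M) ∧
    fderiv ℝ ψ = (b.normed μ ⋆[ContinuousLinearMap.lsmul ℝ ℝ, μ] (fderiv ℝ φ)) := by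
  intro ψ
  have hfd : fderiv ℝ ψ = (b.normed μ ⋆[ContinuousLinearMap.lsmul ℝ ℝ, μ] (fderiv ℝ φ)) := by
    funext x
    have h := (hφc.hasFDerivAt_convolution_right (μ := μ) (f := b.normed μ)
      (ContinuousLinearMap.lsmul ℝ ℝ)
      b.continuous_normed.locallyIntegrable hφ x).fderiv
    exact h
  refine ⟨?_, ?_, fun x => ?_, fun x => ?_, hfd⟩
  · exact b.hasCompactSupport_normed.contDiff_convolution_left _ b.contDiff_normed
      hφ.continuous.locallyIntegrable
  · refine closure_minimal (fun x hx => ?_) Metric.isClosed_cthickening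
    obtain ⟨y, hy, z, hz, rfl⟩ := support_convolution_subset _ hx
    rw [b.support_normed_eq, mem_ball_zero_iff] at hy
    refine Metric.mem_cthickening_of_dist_le _ z _ _ (subset_tsupport _ hz) ?_
    simpa [dist_eq_norm] using hy.le
  · exact integral_nonneg fun t => mul_nonneg (b.nonneg_normed t) (hφ0 _)
  · rw [hfd]
    simpa using dist_convolution_le (μ := μ) (x₀ := x) (z₀ := (0 : E →L[ℝ] ℝ)) hM0
      b.support_normed_eq.subset b.nonneg_normed b.integral_normed
      (hφ.continuous_fderiv one_ne_zero).aestronglyMeasurable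
      (fun y _ => by simpa using hM y)

open scoped ContDiff in
theorem integral_fderiv_apply_nonpos_of_smooth {U : Set E} (hU : IsOpen U) {X : E → E}
    (hX : ContinuousOn X U)
    (h : ∀ ψ : E → ℝ, ContDiff ℝ ∞ ψ → HasCompactSupport ψ → tsupport ψ ⊆ U → (∀ x, 0 ≤ ψ x) →
      ∫ x, fderiv ℝ ψ x (X x) ∂μ ≤ 0)
    {φ : E → ℝ} (hφ : ContDiff ℝ 1 φ) (hφc : HasCompactSupport φ) (hφU : tsupport φ ⊆ U)
    (hφ0 : ∀ x, 0 ≤ φ x) : ∫ x, fderiv ℝ φ x (X x) ∂μ ≤ 0 := by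
  obtain ⟨δ, hδ, hδU⟩ := hφc.isCompact.exists_cthickening_subset_open hU hφU
  have hK : IsCompact (Metric.cthickening δ (tsupport φ)) := hφc.isCompact.cthickening
  have hφ' := hφ.continuous_fderiv one_ne_zero
  obtain ⟨M, hM⟩ := hφ'.bounded_above_of_compact_support (hφc.fderiv ℝ)
  have hM0 : 0 ≤ M := (norm_nonneg _).trans (hM 0)
  let b : ℕ → ContDiffBump (0 : E) := fun k =>
    ⟨δ / (k + 1) / 2, δ / (k + 1), by positivity, half_lt_self (by positivity)⟩
  have hb : Filter.Tendsto (fun k => (b k).rOut) Filter.atTop (nhds 0) :=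
    by
    simpa [b, div_eq_mul_inv] using tendsto_one_div_add_atTop_nhds_zero_nat.const_mul δ
  have hbδ : ∀ k, (b k).rOut ≤ δ := fun k => div_le_self hδ.le (by simp)
  have hprop := fun k => (b k).normed_convolution_properties (μ := μ) hφ hφc hφ0 hM0 hM
  set ψ : ℕ → E → ℝ := fun k => convolution ((b k).normed μ) φ (ContinuousLinearMap.lsmul ℝ ℝ) μ
  have hsupp : ∀ k, tsupport (ψ k) ⊆ Metric.cthickening δ (tsupport φ) := fun k =>
    (hprop k).2.1.trans (Metric.cthickening_mono (hbδ k) _)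
  have hlim : Filter.Tendsto (fun k => ∫ x, fderiv ℝ (ψ k) x (X x) ∂μ) Filter.atTop
      (nhds (∫ x, fderiv ℝ φ x (X x) ∂μ)) := by
    refine tendsto_integral_of_dominated_convergence
      ((Metric.cthickening δ (tsupport φ)).indicator fun x => M * ‖X x‖) (fun k => ?_) ?_
      (fun k => .of_forall fun x => ?_) (.of_forall fun x => ?_)
    · exact (continuous_fderiv_apply_of_tsupport_subset hU hX ((hprop k).1.of_le (by simp))
        ((hsupp k).trans hδU)).aestronglyMeasurable
    · rw [integrable_indicator_iff hK.measurableSet]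
      exact ((hX.mono hδU).norm.const_mul M).integrableOn_compact hK
    · by_cases hx : x ∈ Metric.cthickening δ (tsupport φ)
      · rw [Set.indicator_of_mem hx]
        exact (ContinuousLinearMap.le_opNorm _ _).trans
          (mul_le_mul_of_nonneg_right ((hprop k).2.2.2.1 x) (norm_nonneg _))
      · have : fderiv ℝ (ψ k) x = 0 := by
          by_contra h0
          exact hx (hsupp k (support_fderiv_subset ℝ h0))
        simp [this, hx]
    · have := ContDiffBump.convolution_tendsto_right_of_continuous (μ := μ) hb hφ' x
      have h2 : Filter.Tendsto (fun k => fderiv ℝ (ψ k) x) Filter.atTop (nhds (fderiv ℝ φ x)) := by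
        refine this.congr fun k => ?_
        rw [(hprop k).2.2.2.2]
      exact ((ContinuousLinearMap.apply ℝ ℝ (X x)).continuous.tendsto _).comp h2
  refine le_of_tendsto' hlim fun k => h _ (hprop k).1 ?_ ((hsupp k).trans hδU) (hprop k).2.2.1
  exact hK.of_isClosed_subset (isClosed_tsupport _) (hsupp k)

end SmoothApproximation

section Comparison

variable {E : Type*} [NormedAddCommGroup E] [InnerProductSpace ℝ E]

/-- The flux `‖z‖^{p-2} z` of the `p`-Laplacian. -/
def pFlux (p : ℝ) (z : E) : E := ‖z‖ ^ (p - 2) • z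

theorem norm_pFlux {p : ℝ} (hp : 1 < p) (z : E) : ‖pFlux p z‖ = ‖z‖ ^ (p - 1) := by
  rw [pFlux, norm_smul, Real.norm_of_nonneg (by positivity),
    ← Real.rpow_add_one' (norm_nonneg z) (by linarith)]
  ring_nf

theorem continuous_pFlux {p : ℝ} (hp : 1 < p) : Continuous (pFlux p : E → E) := by
  refine continuous_iff_continuousAt.2 fun z => ?_
  by_cases hz : z = 0
  · subst hz
    have h0 : pFlux p (0 : E) = 0 := by simp [pFlux]
    rw [ContinuousAt, h0, tendsto_zero_iff_norm_tendsto_zero]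
    simp_rw [norm_pFlux hp]
    have hc : ContinuousAt (fun z : E => ‖z‖ ^ (p - 1)) 0 :=
      continuous_norm.continuousAt.rpow_const (Or.inr (by linarith))
    have := hc.tendsto
    rwa [norm_zero, Real.zero_rpow (by linarith)] at this
  · exact (continuous_norm.continuousAt.rpow_const (Or.inl (norm_ne_zero_iff.2 hz))).smul
      continuousAt_id

theorem inner_pFlux_sub_nonneg_and_eq {p : ℝ} (hp : 1 < p) (a b : E) :
    0 ≤ ⟪pFlux p a - pFlux p b, a - b⟫ ∧ (⟪pFlux p a - pFlux p b, a - b⟫ = 0 → a = b) := by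
  have hcs := real_inner_le_norm a b
  have hs : ∀ z : E, ‖z‖ ^ (p - 2) * ‖z‖ = ‖z‖ ^ (p - 1) := fun z => by
    rw [← Real.rpow_add_one' (norm_nonneg z) (by linarith)]
    ring_nf
  have key : ⟪pFlux p a - pFlux p b, a - b⟫ =
      (‖a‖ ^ (p - 1) - ‖b‖ ^ (p - 1)) * (‖a‖ - ‖b‖) +
      (‖a‖ ^ (p - 2) + ‖b‖ ^ (p - 2)) * (‖a‖ * ‖b‖ - ⟪a, b⟫) := by
    simp only [pFlux, inner_sub_left, inner_sub_right, real_inner_smul_left,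
      real_inner_self_eq_norm_sq, ← hs, real_inner_comm a b]
    ring
  have h1 : 0 ≤ (‖a‖ ^ (p - 1) - ‖b‖ ^ (p - 1)) * (‖a‖ - ‖b‖) := by
    rcases le_total ‖a‖ ‖b‖ with h | h
    · exact mul_nonneg_of_nonpos_of_nonpos
        (sub_nonpos.2 (Real.rpow_le_rpow (norm_nonneg _) h (by linarith))) (sub_nonpos.2 h)
    · exact mul_nonneg
        (sub_nonneg.2 (Real.rpow_le_rpow (norm_nonneg _) h (by linarith))) (sub_nonneg.2 h)
  have h2 : 0 ≤ (‖a‖ ^ (p - 2) + ‖b‖ ^ (p - 2)) * (‖a‖ * ‖b‖ - ⟪a, b⟫) :=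
    mul_nonneg (by positivity) (sub_nonneg.2 hcs)
  rw [key]
  refine ⟨add_nonneg h1 h2, fun h0 => ?_⟩
  obtain ⟨e1, e2⟩ := (add_eq_zero_iff_of_nonneg h1 h2).1 h0
  have hn : ‖a‖ = ‖b‖ := by
    rcases mul_eq_zero.1 e1 with h | h
    · exact (Real.rpow_left_inj (norm_nonneg _) (norm_nonneg _) (by linarith)).1 (sub_eq_zero.1 h)
    · exact sub_eq_zero.1 h
  by_cases ha : a = 0
  · subst ha
    rw [norm_zero] at hn
    exact (norm_eq_zero.1 hn.symm).symm
  have hpos : 0 < ‖a‖ := norm_pos_iff.2 ha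
  have hi : ⟪a, b⟫ = ‖a‖ * ‖b‖ := by
    rcases mul_eq_zero.1 e2 with h | h
    · have := Real.rpow_pos_of_pos hpos (p - 2)
      have := Real.rpow_nonneg (norm_nonneg b) (p - 2)
      linarith
    · linarith
  have := inner_eq_norm_mul_iff_real.1 hi
  rw [hn] at this hpos
  exact smul_right_injective E hpos.ne' this

variable [FiniteDimensional ℝ E] [Nontrivial E] [MeasurableSpace E] [BorelSpace E]

open scoped ContDiff in
/-- Weak comparison principle for the `p`-Laplacian in a bounded open set `U`. -/
theorem le_of_weak_pLaplacian_le {p : ℝ} (hp : 1 < p) {U : Set E} (hU : IsOpen U)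
    (hUb : Bornology.IsBounded U) {v w : E → ℝ} (hv : Continuous v) (hw : Continuous w)
    (hv1 : ContDiffOn ℝ 1 v U) (hw1 : ContDiffOn ℝ 1 w U) (hvw : ∀ x ∉ U, v x ≤ w x)
    (h : ∀ ψ : E → ℝ, ContDiff ℝ ∞ ψ → HasCompactSupport ψ → tsupport ψ ⊆ U → (∀ x, 0 ≤ ψ x) →
      ∫ x, fderiv ℝ ψ x (pFlux p (gradient v x) - pFlux p (gradient w x)) ≤ 0) (x : E) :
    v x ≤ w x := by
  have hgrad : ∀ u : E → ℝ, ContDiffOn ℝ 1 u U → ContinuousOn (gradient u) U := fun u hu =>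
    (InnerProductSpace.toDual ℝ E).symm.continuous.comp_continuousOn
      (hu.continuousOn_fderiv_of_isOpen hU le_rfl)
  set X : E → E := fun x => pFlux p (gradient v x) - pFlux p (gradient w x) with hXdef
  have hX : ContinuousOn X U := ((continuous_pFlux hp).comp_continuousOn (hgrad v hv1)).sub
    ((continuous_pFlux hp).comp_continuousOn (hgrad w hw1))
  refine le_of_forall_pos_le_add fun η hη => ?_
  set φ : E → ℝ := fun x => expNegInvGlue (v x - w x - η) with hφdef
  have hcl : IsClosed {x | η ≤ v x - w x} := isClosed_le continuous_const (hv.sub hw)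
  have hsub : {x | η ≤ v x - w x} ⊆ U := fun x hx => by
    by_contra hxU
    have := hvw x hxU
    simp only [Set.mem_ofPred_eq] at hx
    linarith
  have hts : tsupport φ ⊆ {x | η ≤ v x - w x} := by
    refine closure_minimal (fun x hx => ?_) hcl
    by_contra hlt
    simp only [Set.mem_ofPred_eq, not_le] at hlt
    exact hx (expNegInvGlue.zero_of_nonpos (by linarith))
  have hφU := hts.trans hsub
  have hφc : HasCompactSupport φ :=
    Metric.isCompact_of_isClosed_isBounded (isClosed_tsupport φ) (hUb.subset hφU)
  have hφ : ContDiff ℝ 1 φ := by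
    refine contDiff_iff_contDiffAt.2 fun x => ?_
    by_cases hx : x ∈ tsupport φ
    swap
    · exact contDiffAt_const.congr_of_eventuallyEq (notMem_tsupport_iff_eventuallyEq.1 hx)
    have hxU := hU.mem_nhds (hφU hx)
    exact (expNegInvGlue.contDiff (n := 1)).contDiffAt.comp x
      (((hv1.contDiffAt hxU).sub (hw1.contDiffAt hxU)).sub contDiffAt_const)
  have hφ0 : ∀ x, 0 ≤ φ x := fun x => expNegInvGlue.nonneg _
  have hle := integral_fderiv_apply_nonpos_of_smooth (μ := volume) hU hX h hφ hφc hφU hφ0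
  have hderiv : ∀ x ∈ U, fderiv ℝ φ x = deriv expNegInvGlue (v x - w x - η) •
      InnerProductSpace.toDual ℝ E (gradient v x - gradient w x) := fun x hx => by
    have hxU := hU.mem_nhds hx
    have h1 := ((hv1.contDiffAt hxU).differentiableAt one_ne_zero).hasFDerivAt
    have h2 := ((hw1.contDiffAt hxU).differentiableAt one_ne_zero).hasFDerivAt
    have h3 := (((expNegInvGlue.contDiff (n := 1)).differentiable one_ne_zero)
      (v x - w x - η)).hasDerivAt
    have h4 := (h3.comp_hasFDerivAt x ((h1.sub h2).sub_const η)).fderiv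
    rw [map_sub, toDual_gradient, toDual_gradient]
    exact h4
  have hnonneg : ∀ x, 0 ≤ fderiv ℝ φ x (X x) := fun x => by
    by_cases hx : x ∈ tsupport φ
    · rw [hderiv x (hφU hx)]
      simp only [smul_apply, InnerProductSpace.toDual_apply_apply, smul_eq_mul]
      rw [real_inner_comm]
      exact mul_nonneg expNegInvGlue.monotone.deriv_nonneg (inner_pFlux_sub_nonneg_and_eq hp _ _).1
    · have : fderiv ℝ φ x = 0 := by
        by_contra h0
        exact hx (support_fderiv_subset ℝ h0)
      simp [this]
  have hzero : ∀ x, fderiv ℝ φ x (X x) = 0 := fun x => by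
    by_contra hx
    exact absurd hle (not_le.2
      ((continuous_fderiv_apply_of_tsupport_subset hU hX hφ hφU).integral_pos_of_hasCompactSupport_nonneg_nonzero
        (hasCompactSupport_fderiv_apply hφc X) hnonneg hx))
  have hfd : ∀ x, fderiv ℝ φ x = 0 := fun x => by
    by_contra hx
    have hxU := hφU (support_fderiv_subset ℝ hx)
    have h0 := hzero x
    rw [hderiv x hxU] at h0 hx
    simp only [smul_apply, InnerProductSpace.toDual_apply_apply,
      smul_eq_mul] at h0
    rw [real_inner_comm] at h0
    rcases mul_eq_zero.1 h0 with h0 | h0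
    · exact hx (by simp [h0])
    · exact hx (by simp [(inner_pFlux_sub_nonneg_and_eq hp _ _).2 h0])
  by_contra hlt
  have hφx : 0 < φ x := expNegInvGlue.pos_of_pos (by linarith)
  refine NormedSpace.unbounded_univ ℝ E (hφc.isCompact.isBounded.subset fun y _ => ?_)
  refine subset_tsupport φ ?_
  rw [Function.mem_support, is_const_of_fderiv_eq_zero (hφ.differentiable one_ne_zero) hfd y x]
  exact hφx.ne'

end Comparison

section Divergence

variable {E : Type*} [NormedAddCommGroup E] [InnerProductSpace ℝ E] [FiniteDimensional ℝ E]
  [MeasurableSpace E] [BorelSpace E]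

/-- Integration by parts against the radially directed field `x ↦ c x • x`. -/
theorem integral_fderiv_apply_smul_self {c : E → ℝ} (hc : ContDiff ℝ 1 c) {φ : E → ℝ}
    (hφ : ContDiff ℝ 1 φ) (hφc : HasCompactSupport φ) :
    ∫ x, fderiv ℝ φ x (c x • x) =
      -∫ x, (Module.finrank ℝ E * c x + fderiv ℝ c x x) * φ x := by
  let b := stdOrthonormalBasis ℝ E
  let f : Fin (Module.finrank ℝ E) → E → ℝ := fun i x => c x * ⟪b i, x⟫
  have hf : ∀ i, ContDiff ℝ 1 (f i) := fun i => hc.mul (contDiff_const.inner ℝ contDiff_id)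
  have hc' := hc.continuous_fderiv one_ne_zero
  have hφ' := hφ.continuous_fderiv one_ne_zero
  have hf' : ∀ i x, fderiv ℝ (f i) x (b i) = c x + ⟪b i, x⟫ * fderiv ℝ c x (b i) := fun i x => by
    have h1 := ((hc.differentiable one_ne_zero) x).hasFDerivAt
    have h2 : HasFDerivAt (fun x => ⟪b i, x⟫) (innerSL ℝ (b i)) x := (innerSL ℝ (b i)).hasFDerivAt
    have h3 := (h1.mul h2).fderiv
    rw [show fderiv ℝ (f i) x = _ from h3]
    simp
  have hint1 : ∀ i, Integrable fun x => fderiv ℝ (f i) x (b i) * φ x := fun i =>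
    ((((hf i).continuous_fderiv one_ne_zero).clm_apply continuous_const).mul
      hφ.continuous).integrable_of_hasCompactSupport hφc.mul_left
  have hint2 : ∀ i, Integrable fun x => f i x * fderiv ℝ φ x (b i) := fun i =>
    ((hf i).continuous.mul (hφ'.clm_apply continuous_const)).integrable_of_hasCompactSupport
      (hasCompactSupport_fderiv_apply hφc fun _ => b i).mul_left
  have hint3 : ∀ i, Integrable fun x => f i x * φ x := fun i =>
    ((hf i).continuous.mul hφ.continuous).integrable_of_hasCompactSupport hφc.mul_left
  have hb : ∀ (l : E →L[ℝ] ℝ) (x : E), l x = ∑ i, ⟪b i, x⟫ * l (b i) := fun l x => by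
    conv_lhs => rw [← b.sum_repr' x]
    simp
  have hL : ∀ x, fderiv ℝ φ x (c x • x) = ∑ i, f i x * fderiv ℝ φ x (b i) := fun x => by
    rw [map_smul, hb (fderiv ℝ φ x), smul_eq_mul, Finset.mul_sum]
    exact Finset.sum_congr rfl fun i _ => (mul_assoc _ _ _).symm
  have hR : ∀ x, (Module.finrank ℝ E * c x + fderiv ℝ c x x) * φ x =
      ∑ i, fderiv ℝ (f i) x (b i) * φ x := fun x => by
    rw [← Finset.sum_mul]
    congr 1
    simp_rw [hf', Finset.sum_add_distrib]
    congr 1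
    · simp
    · exact hb _ x
  simp_rw [hL, hR]
  rw [integral_finsetSum _ fun i _ => hint2 i, integral_finsetSum _ fun i _ => hint1 i,
    ← Finset.sum_neg_distrib]
  exact Finset.sum_congr rfl fun i _ => integral_mul_fderiv_eq_neg_fderiv_mul_of_integrable
    (hint1 i) (hint2 i) (hint3 i) (fun x _ => (hf i).differentiable one_ne_zero x)
    (fun x _ => hφ.differentiable one_ne_zero x)

end Divergence

section Barrier

variable {E : Type*} [NormedAddCommGroup E] [InnerProductSpace ℝ E]

theorem pFlux_pFlux {p : ℝ} (hp : 1 < p) (z : E) : pFlux p (pFlux (p / (p - 1)) z) = z := by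
  have hp' : 0 < p - 1 := by linarith
  have hq : 1 < p / (p - 1) := by rw [lt_div_iff₀ hp']; linarith
  by_cases hz : z = 0
  · simp [hz, pFlux]
  have hz' : 0 < ‖z‖ := norm_pos_iff.2 hz
  rw [pFlux, norm_pFlux hq, pFlux, smul_smul, ← Real.rpow_mul hz'.le, ← Real.rpow_add hz']
  rw [show (p / (p - 1) - 1) * (p - 2) + (p / (p - 1) - 2) = 0 by field_simp; ring]
  simp

/-- The radial coefficient `c` of the barrier flux `-L c(|x|) x`. -/
def barrierCoeff (N δ : ℝ) (r : ℝ) : ℝ :=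
  2 * (1 + r ^ 2) ^ (-N / 2) - (1 + r ^ 2) ^ (-(N + δ) / 2)

theorem continuous_barrierCoeff (N δ : ℝ) : Continuous (barrierCoeff N δ) := by
  have h : Continuous fun r : ℝ => 1 + r ^ 2 := by fun_prop
  have h0 : ∀ r : ℝ, 1 + r ^ 2 ≠ 0 := fun r => by positivity
  exact ((h.rpow_const fun r => Or.inl (h0 r)).const_mul 2).sub
    (h.rpow_const fun r => Or.inl (h0 r))

theorem barrierCoeff_nonneg {N δ : ℝ} (hδ : 0 ≤ δ) (r : ℝ) : 0 ≤ barrierCoeff N δ r := by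
  have h1 : (1 + r ^ 2) ^ (-(N + δ) / 2) ≤ (1 + r ^ 2) ^ (-N / 2) :=
    Real.rpow_le_rpow_of_exponent_le (by nlinarith [sq_nonneg r]) (by linarith)
  have h2 : (0 : ℝ) ≤ (1 + r ^ 2) ^ (-N / 2) := by positivity
  rw [barrierCoeff]
  linarith

theorem mul_barrierCoeff_le {N : ℝ} (hN : 1 ≤ N) (δ : ℝ) {r : ℝ} (hr : 0 ≤ r) :
    r * barrierCoeff N δ r ≤ 2 * 2 ^ ((N - 1) / 2) * (1 + r) ^ (-(N - 1)) := by
  have hs : 0 < 1 + r ^ 2 := by positivity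
  have h1 : barrierCoeff N δ r ≤ 2 * (1 + r ^ 2) ^ (-N / 2) :=
    sub_le_self _ (by positivity)
  have h2 : r ≤ (1 + r ^ 2) ^ (1 / 2 : ℝ) := by
    rw [← Real.sqrt_eq_rpow]
    exact Real.le_sqrt_of_sq_le (by linarith)
  have h3 : (1 + r ^ 2) ^ (-((N - 1) / 2)) ≤ 2 ^ ((N - 1) / 2) * (1 + r) ^ (-(N - 1)) := by
    have h4 : ((1 + r) ^ 2 / 2) ^ ((N - 1) / 2) ≤ (1 + r ^ 2) ^ ((N - 1) / 2) :=
      Real.rpow_le_rpow (by positivity) (by nlinarith [sq_nonneg (r - 1)]) (by linarith)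
    rw [Real.div_rpow (by positivity) (by norm_num), ← Real.rpow_natCast, ← Real.rpow_mul
      (by positivity)] at h4
    rw [Real.rpow_neg hs.le, Real.rpow_neg (by positivity), ← div_eq_mul_inv,
      inv_le_comm₀ (by positivity) (by positivity), inv_div]
    have h5 : ((2 : ℕ) : ℝ) * ((N - 1) / 2) = N - 1 := by push_cast; ring
    rwa [h5] at h4
  calc r * barrierCoeff N δ r
      ≤ r * (2 * (1 + r ^ 2) ^ (-N / 2)) := by gcongr
    _ ≤ (1 + r ^ 2) ^ (1 / 2 : ℝ) * (2 * (1 + r ^ 2) ^ (-N / 2)) := by gcongr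
    _ = 2 * (1 + r ^ 2) ^ (-((N - 1) / 2)) := by
      rw [mul_left_comm, ← Real.rpow_add hs, show 1 / 2 + -N / 2 = -((N - 1) / 2) by ring]
    _ ≤ _ := by rw [mul_assoc]; gcongr

theorem contDiff_barrierCoeff_norm (N δ : ℝ) :
    ContDiff ℝ 1 fun x : E => barrierCoeff N δ ‖x‖ := by
  have h : ContDiff ℝ 1 fun x : E => 1 + ‖x‖ ^ 2 := contDiff_const.add (contDiff_norm_sq ℝ)
  have h0 : ∀ x : E, 1 + ‖x‖ ^ 2 ≠ 0 := fun x => by positivity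
  exact (contDiff_const.mul (h.rpow_const_of_ne h0)).sub (h.rpow_const_of_ne h0)

theorem barrierCoeff_divergence_ge {N δ : ℝ} (hδ : 0 ≤ δ) (hδN : δ ≤ N) (x : E) :
    δ * (1 + ‖x‖ ^ 2) ^ (-(N + δ) / 2) ≤ N * barrierCoeff N δ ‖x‖ +
      fderiv ℝ (fun x : E => barrierCoeff N δ ‖x‖) x x := by
  have hs : 0 < 1 + ‖x‖ ^ 2 := by positivity
  have hd : ∀ q : ℝ, HasFDerivAt (fun x : E => (1 + ‖x‖ ^ 2) ^ q)
      ((q * (1 + ‖x‖ ^ 2) ^ (q - 1)) • (2 • innerSL ℝ x)) x := fun q =>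
    ((hasStrictFDerivAt_norm_sq x).hasFDerivAt.const_add 1).rpow_const (Or.inl hs.ne')
  have hsplit : ∀ q : ℝ, (1 + ‖x‖ ^ 2) ^ (q - 1) * ‖x‖ ^ 2 =
      (1 + ‖x‖ ^ 2) ^ q - (1 + ‖x‖ ^ 2) ^ (q - 1) := fun q => by
    have : (1 + ‖x‖ ^ 2) ^ q = (1 + ‖x‖ ^ 2) ^ (q - 1) * (1 + ‖x‖ ^ 2) := by
      rw [← Real.rpow_add_one hs.ne', sub_add_cancel]
    rw [this]
    ring
  have hfd := (((hd (-N / 2)).const_mul 2).sub (hd (-(N + δ) / 2))).fderiv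
  rw [show fderiv ℝ (fun x : E => barrierCoeff N δ ‖x‖) x = _ from hfd]
  simp only [sub_apply, smul_apply, innerSL_apply_apply, real_inner_self_eq_norm_sq, smul_eq_mul,
    nsmul_eq_mul, barrierCoeff]
  have e1 := hsplit (-N / 2)
  have e2 := hsplit (-(N + δ) / 2)
  have hmono : (1 + ‖x‖ ^ 2) ^ (-(N + δ) / 2 - 1) ≤ (1 + ‖x‖ ^ 2) ^ (-N / 2 - 1) :=
    Real.rpow_le_rpow_of_exponent_le (by nlinarith [sq_nonneg ‖x‖]) (by linarith)
  have hp : 0 ≤ (1 + ‖x‖ ^ 2) ^ (-(N + δ) / 2 - 1) := by positivity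
  push_cast
  nlinarith [mul_le_mul_of_nonneg_left hmono (by linarith : 0 ≤ 2 * N),
    mul_nonneg hp (by linarith : 0 ≤ N - δ)]

end Barrier

section BarrierSolution

theorem integrableOn_one_add_rpow {κ : ℝ} (hκ : 0 < κ) {r : ℝ} (hr : 0 ≤ r) :
    IntegrableOn (fun t : ℝ => (1 + t) ^ (-κ - 1)) (Set.Ioi r) := by
  simpa only [add_comm] using integrableOn_add_rpow_Ioi_of_lt (a := -κ - 1) (m := 1) (c := r)
    (by linarith) (by linarith)

theorem integral_Ioi_one_add_rpow {κ : ℝ} (hκ : 0 < κ) {r : ℝ} (hr : 0 ≤ r) :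
    ∫ t in Set.Ioi r, (1 + t) ^ (-κ - 1) = (1 + r) ^ (-κ) / κ := by
  have h := integral_Ioi_of_hasDerivAt_of_tendsto' (a := r) (m := 0)
    (f := fun t : ℝ => -((1 + t) ^ (-κ) / κ)) (f' := fun t => (1 + t) ^ (-κ - 1))
    (fun t ht => ?_) (integrableOn_one_add_rpow hκ hr) ?_
  · rw [h]
    ring
  · have ht' : 0 < 1 + t := by linarith [Set.mem_Ici.1 ht]
    refine (((((hasDerivAt_id t).const_add 1).rpow_const (p := -κ) (Or.inl ht'.ne')).div_const
      κ).neg).congr_deriv ?_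
    simp only [id]
    field_simp
  · have h1 : Filter.Tendsto (fun t : ℝ => (1 + t) ^ (-κ)) Filter.atTop (nhds 0) :=
      (tendsto_rpow_neg_atTop hκ).comp (Filter.tendsto_atTop_add_const_left _ 1 Filter.tendsto_id)
    simpa using (h1.div_const κ).neg

variable {E : Type*} [NormedAddCommGroup E] [InnerProductSpace ℝ E]

theorem hasGradientAt_norm [CompleteSpace E] {x : E} (hx : x ≠ 0) :
    HasGradientAt (fun y : E => ‖y‖) (‖x‖⁻¹ • x) x := by
  have hx' : ‖x‖ ^ 2 ≠ 0 := by positivity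
  have h := (hasStrictFDerivAt_norm_sq x).hasFDerivAt.sqrt hx'
  simp only [Real.sqrt_sq (norm_nonneg _)] at h
  rw [hasGradientAt_iff_hasFDerivAt]
  refine h.congr_fderiv ?_
  ext y
  simp
  ring

/-- A function of `‖x‖` whose profile has derivative `g`, with `g 0 = 0`, is differentiable. -/
theorem hasGradientAt_comp_norm [CompleteSpace E] {W g : ℝ → ℝ}
    (hW : ∀ r, 0 ≤ r → HasDerivAt W (g r) r) (hg : g 0 = 0) (x : E) :
    HasGradientAt (fun y : E => W ‖y‖) ((g ‖x‖ * ‖x‖⁻¹) • x) x := by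
  by_cases hx : x = 0
  · subst hx
    rw [hasGradientAt_iff_hasFDerivAt, smul_zero, map_zero]
    have h0 := hW 0 le_rfl
    rw [hg, hasDerivAt_iff_isLittleO_nhds_zero] at h0
    rw [hasFDerivAt_iff_isLittleO_nhds_zero]
    have hn : Filter.Tendsto (fun y : E => ‖y‖) (nhds 0) (nhds 0) := tendsto_norm_zero
    have h1 := h0.comp_tendsto hn
    simp only [smul_zero, sub_zero, zero_add, Function.comp_def] at h1
    simpa only [zero_add, zero_apply, sub_zero, norm_zero] using h1.of_norm_right
  · have h := (hW ‖x‖ (norm_nonneg x)).comp_hasFDerivAt x (hasGradientAt_norm hx).hasFDerivAt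
    rw [hasGradientAt_iff_hasFDerivAt, mul_smul, map_smul]
    exact h

variable [FiniteDimensional ℝ E] [MeasurableSpace E] [BorelSpace E]

/-- A positive radial `C¹` weak supersolution of `-Δ_p w = K (1 + |x|²)^{-(N+δ)/2}` on the whole
space with the decay of the fundamental solution. -/
theorem exists_pLaplacian_barrier {N p δ K : ℝ} (hN : N = Module.finrank ℝ E) (hp : 1 < p)
    (hpN : p < N) (hδ : 0 < δ) (hδN : δ ≤ N) (hK : 0 ≤ K) :
    ∃ (w : E → ℝ) (C : ℝ), 0 < C ∧ ContDiff ℝ 1 w ∧ (∀ x, 0 ≤ w x) ∧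
      (∀ x, w x ≤ C * (1 + ‖x‖) ^ (-((N - p) / (p - 1)))) ∧
      ∀ φ : E → ℝ, ContDiff ℝ 1 φ → HasCompactSupport φ → (∀ x, 0 ≤ φ x) →
        ∫ x, K * (1 + ‖x‖ ^ 2) ^ (-(N + δ) / 2) * φ x ≤
          ∫ x, fderiv ℝ φ x (pFlux p (gradient w x)) := by
  have hp' : 0 < p - 1 := by linarith
  set L : ℝ := K / δ with hL
  have hL0 : 0 ≤ L := by positivity
  set κ : ℝ := (N - p) / (p - 1) with hκdef
  have hκ : 0 < κ := div_pos (by linarith) hp'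
  set b : ℝ → ℝ := barrierCoeff N δ with hb
  have hb0 : ∀ r, 0 ≤ b r := barrierCoeff_nonneg hδ.le
  set G : ℝ → ℝ := fun t => (L * (|t| * b t)) ^ (1 / (p - 1)) with hG
  have hGc : Continuous G := (continuous_const.mul
    (continuous_abs.mul (continuous_barrierCoeff N δ))).rpow_const fun _ => Or.inr (by positivity)
  have hG0 : ∀ t, 0 ≤ G t := fun t =>
    Real.rpow_nonneg (mul_nonneg hL0 (mul_nonneg (abs_nonneg t) (hb0 t))) _
  set D : ℝ := (L * (2 * 2 ^ ((N - 1) / 2))) ^ (1 / (p - 1)) with hD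
  have hD0 : 0 ≤ D := by positivity
  have hGD : ∀ t, 0 ≤ t → G t ≤ D * (1 + t) ^ (-κ - 1) := fun t ht => by
    have h1 : L * (|t| * b t) ≤ L * (2 * 2 ^ ((N - 1) / 2)) * (1 + t) ^ (-(N - 1)) := by
      rw [abs_of_nonneg ht, mul_assoc]
      exact mul_le_mul_of_nonneg_left (mul_barrierCoeff_le (by linarith) δ ht) hL0
    refine (Real.rpow_le_rpow (mul_nonneg hL0 (mul_nonneg (abs_nonneg t) (hb0 t))) h1
      (by positivity)).trans_eq ?_
    rw [Real.mul_rpow (by positivity) (by positivity), ← Real.rpow_mul (by positivity),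
      show -(N - 1) * (1 / (p - 1)) = -κ - 1 by rw [hκdef]; field_simp; ring]
  have hGint : ∀ r, 0 ≤ r → IntegrableOn G (Set.Ioi r) := fun r hr => by
    refine ((integrableOn_one_add_rpow hκ hr).const_mul D).mono'
      hGc.aestronglyMeasurable.restrict ?_
    refine (ae_restrict_iff' measurableSet_Ioi).2 (.of_forall fun t ht => ?_)
    rw [Real.norm_of_nonneg (hG0 t)]
    exact hGD t (hr.trans (le_of_lt ht))
  set W : ℝ → ℝ := fun r => (∫ t in Set.Ioi 0, G t) - ∫ t in (0 : ℝ)..r, G t with hW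
  have hWeq : ∀ r, 0 ≤ r → W r = ∫ t in Set.Ioi r, G t := fun r hr => by
    rw [hW]
    simp only
    rw [← intervalIntegral.integral_interval_add_Ioi (hGint 0 le_rfl) (hGint r hr)]
    ring
  have hWd : ∀ r, 0 ≤ r → HasDerivAt W (-G r) r := fun r _ =>
    (intervalIntegral.integral_hasDerivAt_right (hGc.intervalIntegrable 0 r)
      (hGc.stronglyMeasurableAtFilter _ _) hGc.continuousAt).const_sub _
  have hg0 : -G 0 = 0 := by simp [hG, Real.zero_rpow (by positivity : (p - 1)⁻¹ ≠ 0)]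
  set w : E → ℝ := fun x => W ‖x‖ with hw
  have hq : 1 < p / (p - 1) := by rw [lt_div_iff₀ hp']; linarith
  have hgrad : ∀ x : E, HasGradientAt w (pFlux (p / (p - 1)) (-((L * b ‖x‖) • x))) x := fun x => by
    convert hasGradientAt_comp_norm hWd hg0 x using 1
    by_cases hx : x = 0
    · simp [hx, pFlux]
    have hx' : ‖x‖ ≠ 0 := norm_ne_zero_iff.2 hx
    have hn : ‖(L * b ‖x‖) • x‖ = L * (|‖x‖| * b ‖x‖) := by
      rw [norm_smul, Real.norm_of_nonneg (mul_nonneg hL0 (hb0 _)), abs_norm]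
      ring
    rw [pFlux, norm_neg, hn, smul_neg, smul_smul, ← neg_smul]
    congr 1
    have hexp : p / (p - 1) - 2 + 1 = 1 / (p - 1) := by field_simp; ring
    have hbase : 0 ≤ L * (|‖x‖| * b ‖x‖) :=
      mul_nonneg hL0 (mul_nonneg (abs_nonneg _) (hb0 _))
    have hGx : G ‖x‖ = (L * (|‖x‖| * b ‖x‖)) ^ (p / (p - 1) - 2) * (L * (|‖x‖| * b ‖x‖)) := by
      rw [← Real.rpow_add_one' hbase (by rw [hexp]; positivity), hexp]
    rw [hGx, abs_norm]
    field_simp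
  have hgrad' : ∀ x, gradient w x = pFlux (p / (p - 1)) (-((L * b ‖x‖) • x)) := fun x =>
    (hgrad x).gradient
  have hcC : ContDiff ℝ 1 fun x : E => L * b ‖x‖ :=
    contDiff_const.mul (contDiff_barrierCoeff_norm N δ)
  have hw1 : ContDiff ℝ 1 w := by
    refine contDiff_one_iff_fderiv.2 ⟨fun x => (hgrad x).differentiableAt, ?_⟩
    rw [← toDual_comp_gradient, funext hgrad']
    exact (InnerProductSpace.toDual ℝ E).continuous.comp
      ((continuous_pFlux hq).comp (hcC.continuous.smul continuous_id).neg)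
  refine ⟨w, (D + 1) / κ, by positivity, hw1, fun x => ?_, fun x => ?_, fun φ hφ hφc hφ0 => ?_⟩
  · rw [hw]
    simp only
    rw [hWeq _ (norm_nonneg x)]
    exact integral_nonneg hG0
  · rw [hw]
    simp only
    rw [hWeq _ (norm_nonneg x)]
    calc ∫ t in Set.Ioi ‖x‖, G t ≤ ∫ t in Set.Ioi ‖x‖, D * (1 + t) ^ (-κ - 1) :=
          setIntegral_mono_on (hGint _ (norm_nonneg x))
            ((integrableOn_one_add_rpow hκ (norm_nonneg x)).const_mul D) measurableSet_Ioi
            fun t ht => hGD t ((norm_nonneg x).trans (le_of_lt ht))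
      _ = D / κ * (1 + ‖x‖) ^ (-κ) := by
          rw [integral_const_mul, integral_Ioi_one_add_rpow hκ (norm_nonneg x)]
          ring
      _ ≤ _ := by gcongr; linarith
  · have hflux : ∀ x, pFlux p (gradient w x) = -((L * b ‖x‖) • x) := fun x => by
      rw [hgrad', pFlux_pFlux hp]
    simp_rw [hflux, map_neg, integral_neg]
    rw [integral_fderiv_apply_smul_self hcC hφ hφc, neg_neg]
    have hs : Continuous fun x : E => (1 + ‖x‖ ^ 2) ^ (-(N + δ) / 2) :=
      (by fun_prop : Continuous fun x : E => 1 + ‖x‖ ^ 2).rpow_const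
        fun x => Or.inl (by positivity)
    refine integral_mono
      (((continuous_const.mul hs).mul hφ.continuous).integrable_of_hasCompactSupport hφc.mul_left)
      ((((continuous_const.mul hcC.continuous).add
        ((hcC.continuous_fderiv one_ne_zero).clm_apply continuous_id)).mul
        hφ.continuous).integrable_of_hasCompactSupport hφc.mul_left) fun x => ?_
    refine mul_le_mul_of_nonneg_right ?_ (hφ0 x)
    have h1 := mul_le_mul_of_nonneg_left (barrierCoeff_divergence_ge hδ.le hδN x) hL0
    have hd : DifferentiableAt ℝ (fun x : E => b ‖x‖) x :=
      (contDiff_barrierCoeff_norm N δ).differentiable one_ne_zero x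
    simp only [fderiv_const_mul hd, smul_apply, smul_eq_mul, ← hN]
    calc K * (1 + ‖x‖ ^ 2) ^ (-(N + δ) / 2) = L * (δ * (1 + ‖x‖ ^ 2) ^ (-(N + δ) / 2)) := by
          rw [hL]; field_simp
      _ ≤ _ := h1
      _ = _ := by ring

end BarrierSolution

section SourceBound

variable {N p γ a : ℝ}

theorem Cnpa_nonneg (hp1 : 1 < p) (hpN : p < N) (ha : 0 ≤ a) : 0 ≤ Cnpa N p a := by
  have h1 : 0 ≤ N + a := by linarith
  have h2 : 0 ≤ (N - p) / (p - 1) := div_nonneg (by linarith) (by linarith)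
  exact Real.rpow_nonneg (mul_nonneg h1 (Real.rpow_nonneg h2 _)) _

theorem Urad_nonneg (hp1 : 1 < p) (hpN : p < N) (ha : 0 ≤ a) {R : ℝ} (hR : 0 ≤ R) :
    0 ≤ Urad N p a R :=
  mul_nonneg (Cnpa_nonneg hp1 hpN ha) (by positivity)

theorem Urad_le (hp1 : 1 < p) (hpN : p < N) (hγ : γ ≤ (N - p) / (p - 1)) (ha : 0 ≤ a) {R : ℝ}
    (hR : 1 ≤ R) : Urad N p a R ≤ Cnpa N p a * R ^ (-γ) := by
  have hR0 : 0 < R := by linarith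
  have hp' : 0 < p - 1 := by linarith
  have hpa : 0 < p + a := by linarith
  refine mul_le_mul_of_nonneg_left ?_ (Cnpa_nonneg hp1 hpN ha)
  calc (1 + R ^ ((p + a) / (p - 1))) ^ (-((N - p) / (p + a)))
      ≤ (R ^ ((p + a) / (p - 1))) ^ (-((N - p) / (p + a))) :=
        Real.rpow_le_rpow_of_nonpos (by positivity) (by linarith)
          (neg_nonpos.2 (div_nonneg (by linarith) hpa.le))
    _ = R ^ (-((N - p) / (p - 1))) := by
        rw [← Real.rpow_mul hR0.le]
        congr 1
        field_simp
    _ ≤ R ^ (-γ) := Real.rpow_le_rpow_of_exponent_le hR (by linarith)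

theorem one_le_pS (hp1 : 1 < p) (hpN : p < N) (ha : 0 ≤ a) : 1 ≤ pS N p a := by
  rw [pS, le_div_iff₀ (by linarith)]
  nlinarith [mul_nonneg (by linarith : 0 ≤ p - 1) (by linarith : 0 ≤ N + a)]

theorem weighted_exponent_le (hp1 : 1 < p) (hpN : p < N) (hγ0 : 0 < γ) (ha : 0 ≤ a) {δ : ℝ}
    (hδ0 : 0 ≤ δ) (hδ : δ ≤ N * (γ * p / (N - p) - 1) - γ) :
    a - γ * (pS N p a - 1) ≤ -(N + δ) := by
  have hNp : 0 < N - p := by linarith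
  have h1 : 0 ≤ γ * p / (N - p) - 1 := by
    by_contra h
    nlinarith
  have h2 : γ * pS N p a = (N + a) * (γ * p / (N - p)) := by
    rw [pS]
    field_simp
  nlinarith [mul_nonneg ha h1]

/-- The source term of the approximate problem decays faster than `r^{-N}`, uniformly in the
exponent. -/
theorem source_le (hp1 : 1 < p) (hpN : p < N) (hγ0 : 0 < γ) (hγ : γ ≤ (N - p) / (p - 1))
    {δ : ℝ} (hδ0 : 0 ≤ δ) (hδ : δ ≤ N * (γ * p / (N - p) - 1) - γ) {a₁ c A R r t : ℝ}
    (ha : 0 ≤ a) (haa : a ≤ a₁) (hc : Cnpa N p a ≤ c) (hR : 1 ≤ R) (hr : 0 ≤ r) (hrR : r ≤ R)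
    (ht0 : 0 ≤ t) (ht : (1 + r) ^ γ * t ≤ A) :
    r ^ a * (t + Urad N p a R) ^ (pS N p a - 1) ≤
      (max 1 (A + c * 2 ^ γ)) ^ (pS N p a₁ - 1) * (1 + r ^ 2) ^ (-(N + δ) / 2) := by
  have hr1 : 0 < 1 + r := by linarith
  have hq : 0 ≤ pS N p a - 1 := sub_nonneg.2 (one_le_pS hp1 hpN ha)
  have hc0 : 0 ≤ c := (Cnpa_nonneg hp1 hpN ha).trans hc
  set B := max 1 (A + c * 2 ^ γ) with hB
  have hB1 : 1 ≤ B := le_max_left _ _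
  have ht' : t ≤ A * (1 + r) ^ (-γ) := by
    rw [Real.rpow_neg hr1.le, ← div_eq_mul_inv, le_div_iff₀ (by positivity)]
    linarith
  have hRr : R ^ (-γ) ≤ 2 ^ γ * (1 + r) ^ (-γ) := by
    have h1 : R ^ (-γ) ≤ ((1 + r) / 2) ^ (-γ) :=
      Real.rpow_le_rpow_of_nonpos (by positivity) (by linarith) (by linarith)
    rw [Real.div_rpow hr1.le (by norm_num), Real.rpow_neg (by norm_num : (0 : ℝ) ≤ 2), div_inv_eq_mul,
      mul_comm] at h1
    exact h1
  have hsum : t + Urad N p a R ≤ B * (1 + r) ^ (-γ) :=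
    calc t + Urad N p a R ≤ A * (1 + r) ^ (-γ) + c * (2 ^ γ * (1 + r) ^ (-γ)) :=
          add_le_add ht' ((Urad_le hp1 hpN hγ ha hR).trans
            (mul_le_mul hc hRr (by positivity) hc0))
      _ = (A + c * 2 ^ γ) * (1 + r) ^ (-γ) := by ring
      _ ≤ _ := by gcongr; exact le_max_right _ _
  have hpS : pS N p a - 1 ≤ pS N p a₁ - 1 := by
    have hNp : 0 < N - p := by linarith
    rw [pS, pS]
    gcongr
  calc r ^ a * (t + Urad N p a R) ^ (pS N p a - 1)
      ≤ (1 + r) ^ a * (B * (1 + r) ^ (-γ)) ^ (pS N p a - 1) := by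
        refine mul_le_mul (Real.rpow_le_rpow hr (by linarith) ha)
          (Real.rpow_le_rpow (add_nonneg ht0 (Urad_nonneg hp1 hpN ha (by linarith))) hsum hq)
          (Real.rpow_nonneg (add_nonneg ht0 (Urad_nonneg hp1 hpN ha (by linarith))) _)
          (by positivity)
    _ = B ^ (pS N p a - 1) * (1 + r) ^ (a - γ * (pS N p a - 1)) := by
        rw [Real.mul_rpow (by positivity) (by positivity), ← Real.rpow_mul hr1.le,
          mul_left_comm, ← Real.rpow_add hr1]
        ring_nf
    _ ≤ B ^ (pS N p a₁ - 1) * (1 + r) ^ (-(N + δ)) := by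
        refine mul_le_mul (Real.rpow_le_rpow_of_exponent_le hB1 hpS)
          (Real.rpow_le_rpow_of_exponent_le (by linarith)
            (weighted_exponent_le hp1 hpN hγ0 ha hδ0 hδ)) (by positivity) (by positivity)
    _ ≤ _ := by
        refine mul_le_mul_of_nonneg_left ?_ (by positivity)
        have h2 : (1 + r) ^ (-(N + δ)) = ((1 + r) ^ 2) ^ (-(N + δ) / 2) := by
          rw [← Real.rpow_natCast, ← Real.rpow_mul hr1.le]
          push_cast
          ring_nf
        rw [h2]
        exact Real.rpow_le_rpow_of_nonpos (by positivity) (by nlinarith) (by linarith)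

end SourceBound

/-- A weak solution of the approximate problem lies below every nonnegative weak supersolution
whose right-hand side dominates the source term. -/
theorem IsWeakApproxSol.le_supersolution {N : ℕ} (hN : N ≠ 0) {p a ε : ℝ} (hp1 : 1 < p)
    (hpN : p < N) (ha : 0 ≤ a) {v w g : EuclideanSpace ℝ (Fin N) → ℝ}
    (hv : IsWeakApproxSol N p a ε v) (hw : ContDiff ℝ 1 w) (hw0 : ∀ x, 0 ≤ w x)
    (hg : Continuous g)
    (hwg : ∀ φ : EuclideanSpace ℝ (Fin N) → ℝ, ContDiff ℝ 1 φ → HasCompactSupport φ →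
      (∀ x, 0 ≤ φ x) → ∫ x, g x * φ x ≤ ∫ x, fderiv ℝ φ x (pFlux p (gradient w x)))
    (hsource : ∀ x, ‖x‖ < 1 / ε →
      ‖x‖ ^ a * (v x + Urad N p a (1 / ε)) ^ (pS N p a - 1) ≤ g x)
    (x : EuclideanSpace ℝ (Fin N)) : v x ≤ w x := by
  obtain ⟨hvc, hv1, -, hvz, hvw⟩ := hv
  have : Nonempty (Fin N) := Fin.pos_iff_nonempty.1 (Nat.pos_of_ne_zero hN)
  have hq : 0 ≤ pS N p a - 1 := sub_nonneg.2 (one_le_pS hp1 hpN ha)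
  refine le_of_weak_pLaplacian_le hp1 Metric.isOpen_ball Metric.isBounded_ball hvc hw.continuous
    hv1 hw.contDiffOn (fun y hy => ?_) (fun ψ hψ hψc hψU hψ0 => ?_) x
  · rw [hvz y (by simpa using hy)]
    exact hw0 y
  have hψ1 : ContDiff ℝ 1 ψ := hψ.of_le (by simp)
  have hgradv : ContinuousOn (gradient v) (Metric.ball 0 (1 / ε)) :=
    (InnerProductSpace.toDual ℝ _).symm.continuous.comp_continuousOn
      (hv1.continuousOn_fderiv_of_isOpen Metric.isOpen_ball le_rfl)
  have hgradw : Continuous (gradient w) :=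
    (InnerProductSpace.toDual ℝ _).symm.continuous.comp (hw.continuous_fderiv one_ne_zero)
  have hint : ∀ X : EuclideanSpace ℝ (Fin N) → EuclideanSpace ℝ (Fin N),
      ContinuousOn X (Metric.ball 0 (1 / ε)) → Integrable fun x => fderiv ℝ ψ x (X x) :=
    fun X hX => (continuous_fderiv_apply_of_tsupport_subset Metric.isOpen_ball hX hψ1
      hψU).integrable_of_hasCompactSupport (hasCompactSupport_fderiv_apply hψc X)
  simp_rw [map_sub]
  rw [integral_sub
    (hint (fun x => pFlux p (gradient v x)) ((continuous_pFlux hp1).comp_continuousOn hgradv))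
    (hint (fun x => pFlux p (gradient w x)) ((continuous_pFlux hp1).comp hgradw).continuousOn),
    sub_nonpos]
  have hweak : ∫ x, fderiv ℝ ψ x (pFlux p (gradient v x)) =
      ∫ x, ‖x‖ ^ a * (v x + Urad N p a (1 / ε)) ^ (pS N p a - 1) * ψ x := by
    rw [← hvw ψ hψ hψc hψU]
    refine integral_congr_ae (.of_forall fun x => ?_)
    simp only [pFlux, map_smul, smul_eq_mul]
    rw [real_inner_comm, gradient, gradient, InnerProductSpace.toDual_symm_apply]
  rw [hweak]
  refine le_trans (integral_mono ?_ ?_ fun x => ?_) (hwg ψ hψ1 hψc hψ0)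
  · exact (((continuous_norm.rpow_const fun _ => Or.inr ha).mul
      ((hvc.add continuous_const).rpow_const fun _ => Or.inr hq)).mul
      hψ.continuous).integrable_of_hasCompactSupport hψc.mul_left
  · exact (hg.mul hψ.continuous).integrable_of_hasCompactSupport hψc.mul_left
  · by_cases hx : ‖x‖ < 1 / ε
    · exact mul_le_mul_of_nonneg_right (hsource x hx) (hψ0 x)
    · have : ψ x = 0 := by
        by_contra h0
        exact hx (by simpa using hψU (subset_tsupport ψ h0))
      simp [this]

/-- Uniform decay estimate: if `α_n → α > 0`, `ε_n → 0`, and `v_n` are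
weak solutions of the approximate problems in `B_{1/ε_n}` with uniformly bounded
`D^{1,p}` norms and weighted sup-norms, then `v_n(x) ≤ C (1+|x|)^{-(N-p)/(p-1)}` with `C`
independent of `n`. -/
theorem stmt_11 (N : ℕ) (hN : 2 ≤ N) (p : ℝ) (hp1 : 1 < p) (hpN : p < N)
    (γ : ℝ) (hγ1 : (N : ℝ) * ((N : ℝ) - p) / ((N : ℝ) * p - ((N : ℝ) - p)) < γ)
    (hγ2 : γ < ((N : ℝ) - p) / (p - 1))
    (α : ℝ) (hα : 0 < α) (a e : ℕ → ℝ)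
    (ha : Filter.Tendsto a Filter.atTop (nhds α))
    (he : Filter.Tendsto e Filter.atTop (nhds 0)) (hepos : ∀ n, 0 < e n)
    (v : ℕ → EuclideanSpace ℝ (Fin N) → ℝ)
    (hsol : ∀ n, IsWeakApproxSol N p (a n) (e n) (v n))
    (A : ℝ) (hA : 0 < A)
    (hb1 : ∀ n, (∫ x : EuclideanSpace ℝ (Fin N), ‖gradient (v n) x‖ ^ p) ^ (1 / p) ≤ A)
    (hb2 : ∀ n, ∀ x : EuclideanSpace ℝ (Fin N), (1 + ‖x‖) ^ γ * v n x ≤ A) :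
    ∃ C : ℝ, 0 < C ∧ ∀ n, ∀ x : EuclideanSpace ℝ (Fin N),
      v n x ≤ C * (1 + ‖x‖) ^ (-(((N : ℝ) - p) / (p - 1))) := by
  have hp' : 0 < p - 1 := by linarith
  have hNp : 0 < (N : ℝ) - p := by linarith
  have hden : 0 < (N : ℝ) * p - (N - p) := by nlinarith
  have hγ0 : 0 < γ := lt_of_le_of_lt (by positivity) hγ1
  set κ : ℝ := ((N : ℝ) - p) / (p - 1) with hκ
  have hκ0 : 0 < κ := by positivity
  set δ : ℝ := min N (N * (γ * p / (N - p) - 1) - γ) with hδdef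
  have hδ : 0 < δ := by
    refine lt_min (by linarith) ?_
    have h1 : (N : ℝ) * (γ * p / (N - p) - 1) - γ =
        (γ * (N * p - (N - p)) - N * (N - p)) / (N - p) := by
      field_simp
      ring
    rw [div_lt_iff₀ hden] at hγ1
    rw [h1]
    exact div_pos (by linarith) hNp
  set K : ℝ := (max 1 (A + (Cnpa N p α + 1) * 2 ^ γ)) ^ (pS N p (α + 1) - 1) with hK
  have hK0 : 0 ≤ K := Real.rpow_nonneg (zero_le_one.trans (le_max_left _ _)) _
  obtain ⟨w, C, hC, hw, hw0, hwC, hwK⟩ := exists_pLaplacian_barrier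
    (E := EuclideanSpace ℝ (Fin N)) (N := N) (by simp) hp1 hpN hδ (min_le_left _ _) hK0
  have hCn : Filter.Tendsto (fun n => Cnpa N p (a n)) Filter.atTop (nhds (Cnpa N p α)) := by
    refine Filter.Tendsto.rpow ((ha.const_add _).mul_const _)
      (tendsto_const_nhds.div ((ha.const_add p).const_mul p) (by positivity)) (Or.inl ?_)
    have : 0 < (N : ℝ) + α := by linarith
    positivity
  have hev : ∀ᶠ n in Filter.atTop, ∀ x, v n x ≤ C * (1 + ‖x‖) ^ (-κ) := by
    filter_upwards [ha.eventually_const_lt hα, ha.eventually_lt_const (lt_add_one α),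
      hCn.eventually_lt_const (lt_add_one _), he.eventually_lt_const one_pos] with n h1 h2 h3 h4 x
    refine ((hsol n).le_supersolution (by omega) hp1 hpN h1.le hw hw0 ?_ hwK
      (fun y hy => ?_) x).trans (hwC x)
    · exact continuous_const.mul ((by fun_prop : Continuous fun x : EuclideanSpace ℝ (Fin N) =>
        1 + ‖x‖ ^ 2).rpow_const fun x => Or.inl (by positivity))
    · exact source_le hp1 hpN hγ0 hγ2.le hδ.le (min_le_right _ _) h1.le h2.le h3.le
        ((one_le_div (hepos n)).2 h4.le) (norm_nonneg y) hy.le ((hsol n).2.2.1 y) (hb2 n y)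
  obtain ⟨n₀, hn₀⟩ := Filter.eventually_atTop.1 hev
  have hsingle : ∀ n x, v n x ≤ A * (1 + 1 / e n) ^ κ * (1 + ‖x‖) ^ (-κ) := fun n x => by
    have hen := hepos n
    rcases lt_or_ge ‖x‖ (1 / e n) with hx | hx
    · have h1 : v n x ≤ A := (le_mul_of_one_le_left ((hsol n).2.2.1 x)
        (Real.one_le_rpow (by linarith [norm_nonneg x]) hγ0.le)).trans (hb2 n x)
      have h2 : 1 ≤ (1 + 1 / e n) ^ κ * (1 + ‖x‖) ^ (-κ) := by
        rw [Real.rpow_neg (by positivity), ← div_eq_mul_inv, one_le_div (by positivity)]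
        exact Real.rpow_le_rpow (by positivity) (by linarith) hκ0.le
      rw [mul_assoc]
      exact h1.trans (le_mul_of_one_le_right hA.le h2)
    · rw [(hsol n).2.2.2.1 x hx]
      positivity
  have hterm : ∀ n, 0 ≤ A * (1 + 1 / e n) ^ κ := fun n => by
    have := hepos n
    positivity
  refine ⟨C + ∑ n ∈ Finset.range n₀, A * (1 + 1 / e n) ^ κ,
    add_pos_of_pos_of_nonneg hC (Finset.sum_nonneg fun n _ => hterm n), fun n x => ?_⟩
  rcases lt_or_ge n n₀ with hn | hn
  · refine (hsingle n x).trans (mul_le_mul_of_nonneg_right ?_ (by positivity))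
    exact (Finset.single_le_sum (f := fun n => A * (1 + 1 / e n) ^ κ) (fun n _ => hterm n)
      (Finset.mem_range.2 hn)).trans (le_add_of_nonneg_left hC.le)
  · exact (hn₀ n hn x).trans (mul_le_mul_of_nonneg_right
      (le_add_of_nonneg_right (Finset.sum_nonneg fun n _ => hterm n)) (by positivity))
end
end

section
/- Let p ≥ 2 be a real number and N ≥ 1 an integer. Then for all a, b ∈ ℝ^N the following hold: (i) ∫₀¹ |(1−t)a + t b|^{p−2} dt ≥ c(p) |a|^{p−2}, where c(p) := min{ 2^{1−p}, 2^{2−p}/(p−1) } > 0; (ii) ∫₀¹ |(1−t)a + t b|^{p−2} dt ≤ (|a| + |b|)^{p−2}. -/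
open MeasureTheory Real intervalIntegral

noncomputable section

/-- The integral of a power of the absolute value over an interval containing the origin. -/
lemma integral_abs_rpow_neg_pos {q A B : ℝ} (hq : 0 ≤ q) (hA : 0 ≤ A) (hB : 0 ≤ B) :
    ∫ x in (-B)..A, |x| ^ q = (A ^ (q + 1) + B ^ (q + 1)) / (q + 1) := by
  have hc : Continuous fun x : ℝ => |x| ^ q :=
    continuous_abs.rpow_const fun _ => Or.inr hq
  have hpos : ∀ {C : ℝ}, 0 ≤ C → ∫ x in (0 : ℝ)..C, |x| ^ q = C ^ (q + 1) / (q + 1) := by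
    intro C hC
    rw [integral_congr (g := fun x => x ^ q), integral_rpow (Or.inl (by linarith)),
      zero_rpow (by linarith), sub_zero]
    intro x hx
    rw [Set.uIcc_of_le hC] at hx
    simp only [abs_of_nonneg hx.1]
  have hneg : ∫ x in (-B)..0, |x| ^ q = ∫ x in (0 : ℝ)..B, |x| ^ q := by
    simpa using (integral_comp_neg (a := 0) (b := B) fun x : ℝ => |x| ^ q).symm
  rw [← integral_add_adjacent_intervals (hc.intervalIntegrable _ 0) (hc.intervalIntegrable 0 _),
    hneg, hpos hA, hpos hB]
  ring

lemma integral_abs_segment_rpow {q A B : ℝ} (hq : 0 ≤ q) (hA : 0 ≤ A) (hB : 0 ≤ B)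
    (hAB : 0 < A + B) :
    ∫ t in (0 : ℝ)..1, |(1 - t) * A - t * B| ^ q =
      (A ^ (q + 1) + B ^ (q + 1)) / ((q + 1) * (A + B)) := by
  have h := integral_comp_sub_mul (a := 0) (b := 1) (fun x : ℝ => |x| ^ q) hAB.ne' A
  rw [show A - (A + B) * 1 = -B by ring, show A - (A + B) * 0 = A by ring,
    integral_abs_rpow_neg_pos hq hA hB, smul_eq_mul] at h
  rw [show (fun t : ℝ => |(1 - t) * A - t * B| ^ q) = fun t => |A - (A + B) * t| ^ q by
    ext t; ring_nf, h]
  field_simp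

lemma two_rpow_neg_div_mul_rpow_le {q A B : ℝ} (hq : 0 ≤ q) (hA : 0 ≤ A) (hB : 0 ≤ B)
    (hAB : 0 < A + B) :
    (2 : ℝ) ^ (-q) / (q + 1) * A ^ q ≤ (A ^ (q + 1) + B ^ (q + 1)) / ((q + 1) * (A + B)) := by
  have hp : (A + B) ^ (q + 1) ≤ 2 ^ (q + 1 - 1) * (A ^ (q + 1) + B ^ (q + 1)) := by
    lift A to NNReal using hA
    lift B to NNReal using hB
    exact_mod_cast NNReal.rpow_add_le_mul_rpow_add_rpow A B (by linarith : 1 ≤ q + 1)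
  rw [add_sub_cancel_right, rpow_add_one hAB.ne'] at hp
  have hm : A ^ q ≤ (A + B) ^ q := rpow_le_rpow hA (by linarith) hq
  have h2 : (0 : ℝ) < 2 ^ q := by positivity
  rw [rpow_neg zero_le_two, ← div_div, div_right_comm, div_mul_eq_mul_div]
  refine div_le_div_of_nonneg_right ?_ (by linarith)
  rw [inv_mul_eq_div, div_le_div_iff₀ h2 hAB]
  nlinarith

lemma continuous_norm_segment_rpow {E : Type*} [NormedAddCommGroup E] [NormedSpace ℝ E]
    {q : ℝ} (hq : 0 ≤ q) (a b : E) :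
    Continuous fun t : ℝ => ‖(1 - t) • a + t • b‖ ^ q :=
  (by fun_prop : Continuous fun t : ℝ => ‖(1 - t) • a + t • b‖).rpow_const fun _ => Or.inr hq

lemma integral_norm_segment_rpow_le {E : Type*} [NormedAddCommGroup E] [NormedSpace ℝ E]
    {q : ℝ} (hq : 0 ≤ q) (a b : E) :
    ∫ t in (0 : ℝ)..1, ‖(1 - t) • a + t • b‖ ^ q ≤ (‖a‖ + ‖b‖) ^ q := by
  have h := integral_mono_on (μ := volume) (g := fun _ => (‖a‖ + ‖b‖) ^ q) zero_le_one
    ((continuous_norm_segment_rpow hq a b).intervalIntegrable 0 1)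
    (continuous_const.intervalIntegrable 0 1) fun t ht => by
      refine rpow_le_rpow (norm_nonneg _) ((norm_add_le _ _).trans ?_) hq
      rw [norm_smul, norm_smul, norm_of_nonneg ht.1, norm_of_nonneg (sub_nonneg.2 ht.2)]
      nlinarith [norm_nonneg a, norm_nonneg b, ht.1, ht.2]
  simpa using h

lemma le_integral_norm_segment_rpow {E : Type*} [NormedAddCommGroup E] [NormedSpace ℝ E]
    {q : ℝ} (hq : 0 ≤ q) (a b : E) :
    (2 : ℝ) ^ (-q) / (q + 1) * ‖a‖ ^ q ≤ ∫ t in (0 : ℝ)..1, ‖(1 - t) • a + t • b‖ ^ q := by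
  have hab : 0 ≤ ‖a‖ + ‖b‖ := by positivity
  rcases hab.eq_or_lt with h | h
  · have ha : a = 0 := norm_eq_zero.1 (by linarith [norm_nonneg a, norm_nonneg b])
    have hb : b = 0 := norm_eq_zero.1 (by linarith [norm_nonneg a, norm_nonneg b])
    have hc : (2 : ℝ) ^ (-q) / (q + 1) ≤ 1 :=
      div_le_one_of_le₀ ((rpow_le_one_of_one_le_of_nonpos one_le_two (by linarith)).trans
        (by linarith)) (by linarith)
    simpa [ha, hb] using mul_le_of_le_one_left (rpow_nonneg le_rfl q) hc
  · refine (two_rpow_neg_div_mul_rpow_le hq (norm_nonneg a) (norm_nonneg b) h).trans ?_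
    rw [← integral_abs_segment_rpow hq (norm_nonneg a) (norm_nonneg b) h]
    refine integral_mono_on zero_le_one (Continuous.intervalIntegrable ?_ 0 1)
      ((continuous_norm_segment_rpow hq a b).intervalIntegrable 0 1) fun t ht => ?_
    · exact (by fun_prop : Continuous fun t : ℝ => |(1 - t) * ‖a‖ - t * ‖b‖|).rpow_const
        fun _ => Or.inr hq
    · refine rpow_le_rpow (abs_nonneg _) ?_ hq
      have := abs_norm_sub_norm_le ((1 - t) • a) (-(t • b))
      rwa [norm_neg, sub_neg_eq_add, norm_smul, norm_smul, norm_of_nonneg ht.1,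
        norm_of_nonneg (sub_nonneg.2 ht.2)] at this

/-- For `p ≥ 2` and all `a, b ∈ ℝ^N`:
(i) `∫₀¹ |(1-t)a + tb|^{p-2} dt ≥ c(p) |a|^{p-2}` with
`c(p) = min{2^{1-p}, 2^{2-p}/(p-1)} > 0`;
(ii) `∫₀¹ |(1-t)a + tb|^{p-2} dt ≤ (|a| + |b|)^{p-2}`. -/
theorem stmt_13 (N : ℕ) (hN : 1 ≤ N) (p : ℝ) (hp : 2 ≤ p)
    (a b : EuclideanSpace ℝ (Fin N)) :
    (0 : ℝ) < min ((2 : ℝ) ^ (1 - p)) ((2 : ℝ) ^ (2 - p) / (p - 1)) ∧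
    min ((2 : ℝ) ^ (1 - p)) ((2 : ℝ) ^ (2 - p) / (p - 1)) * ‖a‖ ^ (p - 2) ≤
      (∫ t in (0 : ℝ)..1, ‖(1 - t) • a + t • b‖ ^ (p - 2)) ∧
    (∫ t in (0 : ℝ)..1, ‖(1 - t) • a + t • b‖ ^ (p - 2)) ≤ (‖a‖ + ‖b‖) ^ (p - 2) := by
  have hq : 0 ≤ p - 2 := by linarith
  refine ⟨lt_min (by positivity) (div_pos (by positivity) (by linarith)), ?_,
    integral_norm_segment_rpow_le hq a b⟩
  refine (mul_le_mul_of_nonneg_right (min_le_right _ _) (by positivity)).trans ?_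
  have h := le_integral_norm_segment_rpow hq a b
  rwa [neg_sub, show p - 2 + 1 = p - 1 by ring] at h
end
end

section
/- Let p be a real number with 1 < p < 2 and N ≥ 1 an integer. Then for all a, b ∈ ℝ^N with a ≠ 0: the function t ↦ |(1−t)a + t b|^{p−2} is integrable on (0,1), and (|a| + |b|)^{p−2} ≤ ∫₀¹ |(1−t)a + t b|^{p−2} dt ≤ ( 2^{2−p}/(p−1) ) |a|^{p−2}. -/
open MeasureTheory Real intervalIntegral

noncomputable section

theorem intervalIntegrable_abs_rpow_zero_left {r x : ℝ} (hr : -1 < r) (hx : 0 ≤ x) :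
    IntervalIntegrable (fun u : ℝ => |u| ^ r) volume 0 x := by
  refine (intervalIntegrable_rpow' hr).congr fun u hu => ?_
  rw [Set.uIoc_of_le hx] at hu
  simp only [abs_of_pos hu.1]

theorem integral_abs_rpow_zero_left {r x : ℝ} (hr : -1 < r) (hx : 0 ≤ x) :
    ∫ u in (0 : ℝ)..x, |u| ^ r = x ^ (r + 1) / (r + 1) := by
  have h : ∫ u in (0 : ℝ)..x, |u| ^ r = ∫ u in (0 : ℝ)..x, u ^ r := by
    refine integral_congr fun u hu => ?_
    rw [Set.uIcc_of_le hx] at hu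
    simp only [abs_of_nonneg hu.1]
  rw [h, integral_rpow (Or.inl hr), zero_rpow (by linarith), sub_zero]

theorem intervalIntegrable_abs_rpow_neg_left {r x : ℝ} (hr : -1 < r) (hx : 0 ≤ x) :
    IntervalIntegrable (fun u : ℝ => |u| ^ r) volume (-x) 0 := by
  rw [IntervalIntegrable.iff_comp_neg]
  simpa using (intervalIntegrable_abs_rpow_zero_left hr hx).symm

theorem integral_abs_rpow_neg_left {r x : ℝ} (hr : -1 < r) (hx : 0 ≤ x) :
    ∫ u in (-x)..0, |u| ^ r = x ^ (r + 1) / (r + 1) := by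
  rw [← integral_abs_rpow_zero_left hr hx]
  simpa using (integral_comp_neg (a := 0) (b := x) fun u : ℝ => |u| ^ r).symm

theorem intervalIntegrable_abs_sub_mul_rpow {r x y : ℝ} (hr : -1 < r) (hx : 0 < x) (hy : 0 ≤ y) :
    IntervalIntegrable (fun t : ℝ => |x - (x + y) * t| ^ r) volume 0 1 := by
  have hc : x + y ≠ 0 := by positivity
  have h := (((intervalIntegrable_abs_rpow_neg_left hr hy).trans
    (intervalIntegrable_abs_rpow_zero_left hr hx.le)).comp_sub_left x).symm.comp_mul_left (c := x + y)
  simpa [hc] using h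

theorem integral_abs_sub_mul_rpow {r x y : ℝ} (hr : -1 < r) (hx : 0 < x) (hy : 0 ≤ y) :
    ∫ t in (0 : ℝ)..1, |x - (x + y) * t| ^ r =
      (x + y)⁻¹ * ((x ^ (r + 1) + y ^ (r + 1)) / (r + 1)) := by
  have hc : x + y ≠ 0 := by positivity
  rw [integral_comp_sub_mul (fun u : ℝ => |u| ^ r) hc,
    show x - (x + y) * 1 = -y by ring, mul_zero, sub_zero,
    ← integral_add_adjacent_intervals (intervalIntegrable_abs_rpow_neg_left hr hy)
      (intervalIntegrable_abs_rpow_zero_left hr hx.le),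
    integral_abs_rpow_neg_left hr hy, integral_abs_rpow_zero_left hr hx.le, smul_eq_mul]
  ring

theorem rpow_add_rpow_le_two_rpow_mul {q x y : ℝ} (hq0 : 0 ≤ q) (hq1 : q ≤ 1)
    (hx : 0 ≤ x) (hy : 0 ≤ y) :
    x ^ q + y ^ q ≤ 2 ^ (1 - q) * (x + y) ^ q := by
  have h := (concaveOn_rpow hq0 hq1).2 (Set.mem_Ici.2 hx) (Set.mem_Ici.2 hy)
    (by norm_num : (0 : ℝ) ≤ 1 / 2) (by norm_num : (0 : ℝ) ≤ 1 / 2) (by norm_num)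
  simp only [smul_eq_mul] at h
  rw [← mul_add, ← mul_add, mul_rpow (by norm_num) (by positivity), one_div,
    inv_rpow zero_le_two] at h
  rw [rpow_sub zero_lt_two, rpow_one, div_eq_mul_inv]
  linarith

theorem abs_sub_mul_le_norm_segment {E : Type*} [NormedAddCommGroup E] [NormedSpace ℝ E]
    (a b : E) {t : ℝ} (ht0 : 0 ≤ t) (ht1 : t ≤ 1) :
    |‖a‖ - (‖a‖ + ‖b‖) * t| ≤ ‖(1 - t) • a + t • b‖ := by
  have h := abs_norm_sub_norm_le ((1 - t) • a) (-(t • b))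
  rw [norm_neg, norm_smul, norm_smul, norm_of_nonneg ht0, norm_of_nonneg (sub_nonneg.2 ht1),
    sub_neg_eq_add] at h
  rwa [show ‖a‖ - (‖a‖ + ‖b‖) * t = (1 - t) * ‖a‖ - t * ‖b‖ by ring]

theorem norm_segment_le_add {E : Type*} [NormedAddCommGroup E] [NormedSpace ℝ E]
    (a b : E) {t : ℝ} (ht0 : 0 ≤ t) (ht1 : t ≤ 1) :
    ‖(1 - t) • a + t • b‖ ≤ ‖a‖ + ‖b‖ := by
  have h := norm_add_le ((1 - t) • a) (t • b)
  rw [norm_smul, norm_smul, norm_of_nonneg ht0, norm_of_nonneg (sub_nonneg.2 ht1)] at h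
  nlinarith [mul_nonneg ht0 (norm_nonneg a), mul_nonneg (sub_nonneg.2 ht1) (norm_nonneg b)]

/-- For `1 < p < 2` and all `a, b ∈ ℝ^N` with `a ≠ 0`, the function
`t ↦ |(1-t)a + tb|^{p-2}` is integrable on `(0,1)` and
`(|a| + |b|)^{p-2} ≤ ∫₀¹ |(1-t)a + tb|^{p-2} dt ≤ (2^{2-p}/(p-1)) |a|^{p-2}`. -/
theorem stmt_14 (N : ℕ) (hN : 1 ≤ N) (p : ℝ) (hp1 : 1 < p) (hp2 : p < 2)
    (a b : EuclideanSpace ℝ (Fin N)) (ha : a ≠ 0) :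
    IntervalIntegrable (fun t : ℝ => ‖(1 - t) • a + t • b‖ ^ (p - 2)) volume 0 1 ∧
    (‖a‖ + ‖b‖) ^ (p - 2) ≤ (∫ t in (0 : ℝ)..1, ‖(1 - t) • a + t • b‖ ^ (p - 2)) ∧
    (∫ t in (0 : ℝ)..1, ‖(1 - t) • a + t • b‖ ^ (p - 2)) ≤
      (2 : ℝ) ^ (2 - p) / (p - 1) * ‖a‖ ^ (p - 2) := by
  have hx : 0 < ‖a‖ := norm_pos_iff.2 ha
  have hy : 0 ≤ ‖b‖ := norm_nonneg b
  have hr : -1 < p - 2 := by linarith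
  have hr0 : p - 2 ≤ 0 := by linarith
  have hc : 0 < ‖a‖ + ‖b‖ := by positivity
  have hg := intervalIntegrable_abs_sub_mul_rpow hr hx hy
  have hne : ∀ᵐ t : ℝ, t ≠ ‖a‖ / (‖a‖ + ‖b‖) := by
    simp [ae_iff]
  have hpos : ∀ t : ℝ, t ≠ ‖a‖ / (‖a‖ + ‖b‖) → 0 < |‖a‖ - (‖a‖ + ‖b‖) * t| := fun t ht =>
    abs_pos.2 fun h => ht (by rw [eq_div_iff hc.ne']; linarith)
  have hle : ∀ᵐ t : ℝ, t ∈ Set.Icc (0 : ℝ) 1 →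
      ‖(1 - t) • a + t • b‖ ^ (p - 2) ≤ |‖a‖ - (‖a‖ + ‖b‖) * t| ^ (p - 2) := by
    filter_upwards [hne] with t ht htI
    exact rpow_le_rpow_of_nonpos (hpos t ht) (abs_sub_mul_le_norm_segment a b htI.1 htI.2) hr0
  have hge : ∀ᵐ t : ℝ, t ∈ Set.Icc (0 : ℝ) 1 →
      (‖a‖ + ‖b‖) ^ (p - 2) ≤ ‖(1 - t) • a + t • b‖ ^ (p - 2) := by
    filter_upwards [hne] with t ht htI
    exact rpow_le_rpow_of_nonpos
      ((hpos t ht).trans_le (abs_sub_mul_le_norm_segment a b htI.1 htI.2))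
      (norm_segment_le_add a b htI.1 htI.2) hr0
  have hf : IntervalIntegrable (fun t : ℝ => ‖(1 - t) • a + t • b‖ ^ (p - 2)) volume 0 1 := by
    refine hg.mono_fun' (Measurable.aestronglyMeasurable ?_) ?_
    · exact (Continuous.measurable (by fun_prop)).pow_const _
    · rw [Set.uIoc_of_le zero_le_one]
      refine (ae_restrict_iff' measurableSet_Ioc).2 (hle.mono fun t h ht => ?_)
      beta_reduce
      rw [norm_of_nonneg (by positivity)]
      exact h ⟨ht.1.le, ht.2⟩
  refine ⟨hf, ?_, ?_⟩
  · have h := integral_mono_ae_restrict zero_le_one intervalIntegrable_const hf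
      ((ae_restrict_iff' measurableSet_Icc).2 hge)
    simpa using h
  · calc ∫ t in (0 : ℝ)..1, ‖(1 - t) • a + t • b‖ ^ (p - 2)
        ≤ ∫ t in (0 : ℝ)..1, |‖a‖ - (‖a‖ + ‖b‖) * t| ^ (p - 2) :=
          integral_mono_ae_restrict zero_le_one hf hg
            ((ae_restrict_iff' measurableSet_Icc).2 hle)
      _ = (‖a‖ + ‖b‖)⁻¹ * ((‖a‖ ^ (p - 1) + ‖b‖ ^ (p - 1)) / (p - 1)) := by
          rw [integral_abs_sub_mul_rpow hr hx hy, show p - 2 + 1 = p - 1 by ring]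
      _ ≤ (‖a‖ + ‖b‖)⁻¹ * (2 ^ (1 - (p - 1)) * (‖a‖ + ‖b‖) ^ (p - 1) / (p - 1)) := by
          have := sub_pos.2 hp1
          gcongr
          exact rpow_add_rpow_le_two_rpow_mul this.le (by linarith) hx.le hy
      _ = 2 ^ (2 - p) / (p - 1) * (‖a‖ + ‖b‖) ^ (p - 2) := by
          rw [show p - 1 = p - 2 + 1 by ring, rpow_add_one hc.ne',
            show 1 - (p - 2 + 1) = 2 - p by ring]
          field_simp
      _ ≤ 2 ^ (2 - p) / (p - 1) * ‖a‖ ^ (p - 2) := by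
          have := sub_pos.2 hp1
          gcongr ?_ * ?_
          exact rpow_le_rpow_of_nonpos hx (by linarith) hr0
end
end
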